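/- arXiv:2102.04917 — 4 statements merged into one kernel-verified Lean document; each statement's English description precedes it below -/
import Mathlib

section
/- Let R be a Noetherian commutative ring with unity, λ a length function on R-modules, S = R[x₁,…,x_k], N an S-module, and V₀ ≤ N an R-submodule that is finitely generated as an R-module with λ(V₀) < ∞. Then λ(Sₙ·V₀) < ∞ for every n ∈ ℕ, and there exists a polynomial p(t) ∈ ℝ[t] such that Σ_{n∈ℕ} λ(Sₙ·V₀)tⁿ = p(t)/(1 − t)^{k+1} in ℝ[[t]], where Sₙ is the set of polynomials in S of total degree at most n. -/
open scoped ENNReal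

/-- A (generalized) length function on the category of `R`-modules, with values in
`ℝ≥0 ∪ {∞} = ℝ≥0∞`: it vanishes on the zero module, is invariant under isomorphism, is additive
on short exact sequences (equivalently, `λ(M) = λ(N) + λ(M/N)` for every submodule `N ≤ M`), and
is the supremum of its values on finitely generated submodules. -/
structure LengthFunction (R : Type) [CommRing R] : Type 1 where
  l : (M : Type) → [AddCommGroup M] → [Module R M] → ℝ≥0∞
  l_zero : ∀ (M : Type) [AddCommGroup M] [Module R M], Subsingleton M → l M = 0
  l_congr : ∀ (M N : Type) [AddCommGroup M] [Module R M] [AddCommGroup N] [Module R N],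
      (M ≃ₗ[R] N) → l M = l N
  l_add : ∀ (M : Type) [AddCommGroup M] [Module R M] (N : Submodule R M),
      l M = l N + l (M ⧸ N)
  l_fg_sup : ∀ (M : Type) [AddCommGroup M] [Module R M],
      l M = ⨆ (N : Submodule R M) (_ : N.FG), l N

/-- `Sₙ · V`: the `R`-submodule of `M` generated by the products `p • v` with `p ∈ Sₙ` (the
polynomials of total degree at most `n` in `S = R[x₁,…,x_k]`) and `v ∈ V`. -/
def degSmul {R : Type} [CommRing R] (k : ℕ) {M : Type} [AddCommGroup M] [Module R M]
    [Module (MvPolynomial (Fin k) R) M] [IsScalarTower R (MvPolynomial (Fin k) R) M]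
    (n : ℕ) (V : Submodule R M) : Submodule R M :=
  Submodule.span R
    {m : M | ∃ p ∈ MvPolynomial.restrictTotalDegree (Fin k) R n, ∃ v ∈ V, p • v = m}

namespace LengthFunction

variable {R : Type} [CommRing R] (L : LengthFunction R) {N N' : Type} [AddCommGroup N] [Module R N]
  [AddCommGroup N'] [Module R N']

/-- Additivity along the isomorphism `B ⧸ (B ⊓ f⁻¹ A) ≃ (f B ⊔ A) ⧸ A`. -/
theorem l_add_eq_l_map_sup_add (f : N →ₗ[R] N') (B : Submodule R N) (A : Submodule R N') :
    L.l B + L.l A = L.l ↥(B.map f ⊔ A) + L.l ↥(B ⊓ A.comap f) := by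
  set D := B.map f ⊔ A
  have h1 := L.l_add D (A.submoduleOf D)
  have h2 := L.l_add B ((B ⊓ A.comap f).submoduleOf B)
  have hAD : A ≤ D := le_sup_right
  have hKB : B ⊓ A.comap f ≤ B := inf_le_left
  rw [L.l_congr _ _ (Submodule.submoduleOfEquivOfLe hAD)] at h1
  rw [L.l_congr _ _ (Submodule.submoduleOfEquivOfLe hKB)] at h2
  let g : B →ₗ[R] (D ⧸ A.submoduleOf D) := (A.submoduleOf D).mkQ ∘ₗ
    (f.restrict (p := B) (q := D) fun x hx => Submodule.mem_sup_left (Submodule.mem_map_of_mem hx))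
  have hg : Function.Surjective g := by
    intro y
    obtain ⟨⟨d, hd⟩, rfl⟩ := Submodule.mkQ_surjective _ y
    obtain ⟨_, ⟨b, hb, rfl⟩, a, ha, rfl⟩ := Submodule.mem_sup.1 hd
    refine ⟨⟨b, hb⟩, ?_⟩
    simp only [g, LinearMap.comp_apply, Submodule.mkQ_apply]
    rw [Submodule.Quotient.eq]
    simpa [Submodule.submoduleOf] using ha
  have hker : LinearMap.ker g = (B ⊓ A.comap f).submoduleOf B := by
    ext x
    rw [LinearMap.mem_ker]
    change Submodule.Quotient.mk _ = (0 : D ⧸ A.submoduleOf D) ↔ _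
    rw [Submodule.Quotient.mk_eq_zero]
    simp [Submodule.submoduleOf]
  rw [← hker, L.l_congr _ _ (g.quotKerEquivOfSurjective hg)] at h2
  rw [h1, h2]
  ring

theorem l_mono {P Q : Submodule R N} (h : P ≤ Q) : L.l P ≤ L.l Q := by
  have h1 := L.l_add Q (P.submoduleOf Q)
  rw [L.l_congr _ _ (Submodule.submoduleOfEquivOfLe h)] at h1
  exact h1 ▸ le_self_add

theorem l_map_le (f : N →ₗ[R] N') (P : Submodule R N) : L.l (P.map f) ≤ L.l P := by
  have h := L.l_add_eq_l_map_sup_add f P ⊥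
  rw [sup_bot_eq, L.l_zero (⊥ : Submodule R N') inferInstance, add_zero] at h
  exact h ▸ le_self_add

theorem l_sup_le (P Q : Submodule R N) : L.l ↥(P ⊔ Q) ≤ L.l P + L.l Q := by
  have h := L.l_add_eq_l_map_sup_add LinearMap.id P Q
  rw [Submodule.map_id] at h
  exact h ▸ le_self_add

theorem l_finset_sup_lt_top {ι : Type*} (s : Finset ι) (P : ι → Submodule R N)
    (h : ∀ i ∈ s, L.l (P i) < ⊤) : L.l ↥(s.sup P) < ⊤ := by
  classical
  induction s using Finset.induction_on with
  | empty =>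
    rw [Finset.sup_empty, L.l_zero (⊥ : Submodule R N) inferInstance]
    exact ENNReal.zero_lt_top
  | insert i s hi ih =>
    rw [Finset.sup_insert]
    exact (L.l_sup_le _ _).trans_lt (ENNReal.add_lt_top.2
      ⟨h i (by simp), ih fun j hj => h j (by simp [hj])⟩)

/-- The Hilbert series of the graded module `⨁ₙ B n ⧸ A n`. -/
noncomputable def hilbertSeries (A B : ℕ → Submodule R N) : PowerSeries ℝ :=
  PowerSeries.mk fun n => (L.l (B n)).toReal - (L.l (A n)).toReal

end LengthFunction

/-- The families of submodules between `A` and `B` which each operator in `ops` maps from degree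
`n` to degree `n + 1`; they correspond to the graded submodules of `⨁ₙ B n ⧸ A n` over the
polynomial ring with variables acting through `ops`. -/
def stableFamilies {R N : Type*} [CommRing R] [AddCommGroup N] [Module R N]
    (ops : List (Module.End R N)) (A B : ℕ → Submodule R N) : Set (ℕ → Submodule R N) :=
  {W | A ≤ W ∧ W ≤ B ∧ ∀ f ∈ ops, ∀ n, W n ≤ (W (n + 1)).comap f}

section stableFamilies

variable {R N : Type*} [CommRing R] [AddCommGroup N] [Module R N]

theorem exists_forall_ge_eq_of_wellFoundedOn {A B : ℕ → Submodule R N} (hAB : A ≤ B)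
    (h : (stableFamilies [] A B).WellFoundedOn (· > ·)) : ∃ m, ∀ n ≥ m, B n = A n := by
  let W : ℕ → stableFamilies [] A B := fun j =>
    ⟨fun n => if n < j then B n else A n, fun n => by dsimp only; split_ifs <;> simp [hAB n],
      fun n => by dsimp only; split_ifs <;> simp [hAB n], by simp⟩
  obtain ⟨_, ⟨m, rfl⟩, hm⟩ := WellFounded.has_min h (Set.range W) ⟨_, 0, rfl⟩
  refine ⟨m, fun n hn => ?_⟩
  by_contra hne
  refine hm (W (n + 1)) ⟨_, rfl⟩ (lt_of_le_of_ne (fun i => ?_) fun he => hne ?_)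
  · simp only [W]
    split_ifs <;> first | omega | simp [hAB i]
  · have := congrFun he n
    simpa [W, hn.not_gt] using this.symm

variable (x : Module.End R N) (A B : ℕ → Submodule R N)

/-- The degree `n` part of the kernel of `x` on `⨁ₙ B n ⧸ A n`. -/
def kerFamily (n : ℕ) : Submodule R N := B n ⊓ (A (n + 1)).comap x

/-- The submodule of `B n` defining the degree `n` part of the cokernel of `x` on
`⨁ₙ B n ⧸ A n`. -/
def rangeFamily : ℕ → Submodule R N
  | 0 => A 0
  | n + 1 => (B n).map x ⊔ A (n + 1)

variable {x A B} {ops : List (Module.End R N)}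

theorem kerFamily_mem (hx : ∀ f ∈ ops, Commute x f) (hA : A ∈ stableFamilies (x :: ops) A B)
    (hB : B ∈ stableFamilies (x :: ops) A B) : kerFamily x A B ∈ stableFamilies ops A B := by
  refine ⟨fun n => le_inf (hA.2.1 n) (hA.2.2 x (by simp) n), fun n => inf_le_left,
    fun f hf n v hv => ⟨hB.2.2 f (by simp [hf]) n hv.1, ?_⟩⟩
  change x (f v) ∈ A (n + 1 + 1)
  rw [show x (f v) = f (x v) from LinearMap.congr_fun (hx f hf) v]
  exact hA.2.2 f (by simp [hf]) (n + 1) hv.2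

theorem rangeFamily_mem (hx : ∀ f ∈ ops, Commute x f) (hA : A ∈ stableFamilies (x :: ops) A B)
    (hB : B ∈ stableFamilies (x :: ops) A B) : rangeFamily x A B ∈ stableFamilies ops A B := by
  refine ⟨fun n => ?_, fun n => ?_, fun f hf n => ?_⟩
  · cases n with
    | zero => exact le_rfl
    | succ n => exact le_sup_right
  · cases n with
    | zero => exact hA.2.1 0
    | succ n => exact sup_le (Submodule.map_le_iff_le_comap.2 (hB.2.2 x (by simp) n)) (hA.2.1 _)
  · cases n with
    | zero => exact fun v hv => Submodule.mem_sup_right (hA.2.2 f (by simp [hf]) 0 hv)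
    | succ n =>
      refine sup_le (Submodule.map_le_iff_le_comap.2 fun v hv => ?_)
        fun v hv => Submodule.mem_sup_right (hA.2.2 f (by simp [hf]) (n + 1) hv)
      change f (x v) ∈ (B (n + 1)).map x ⊔ A (n + 1 + 1)
      rw [show f (x v) = x (f v) from (LinearMap.congr_fun (hx f hf) v).symm]
      exact Submodule.mem_sup_left (Submodule.mem_map_of_mem (hB.2.2 f (by simp [hf]) n hv))

theorem stableFamilies_kerFamily_subset :
    stableFamilies ops A (kerFamily x A B) ⊆ stableFamilies (x :: ops) A B := by
  refine fun W hW => ⟨hW.1, fun n => (hW.2.1 n).trans inf_le_left, ?_⟩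
  simp only [List.mem_cons, forall_eq_or_imp]
  exact ⟨fun n v hv => hW.1 _ (hW.2.1 n hv).2, hW.2.2⟩

theorem stableFamilies_rangeFamily_subset :
    stableFamilies ops (rangeFamily x A B) B ⊆ stableFamilies (x :: ops) A B := by
  refine fun W hW => ⟨fun n => le_trans ?_ (hW.1 n), hW.2.1, ?_⟩
  · cases n with
    | zero => exact le_rfl
    | succ n => exact le_sup_right
  · simp only [List.mem_cons, forall_eq_or_imp]
    exact ⟨fun n v hv => hW.1 (n + 1)
      (Submodule.mem_sup_left (Submodule.mem_map_of_mem (hW.2.1 n hv))), hW.2.2⟩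

end stableFamilies

namespace LengthFunction

variable {R : Type} [CommRing R] (L : LengthFunction R) {N : Type} [AddCommGroup N] [Module R N]

theorem hilbertSeries_mul_one_sub_X (x : Module.End R N) {A B : ℕ → Submodule R N}
    (hA : ∀ n, L.l (A n) < ⊤) (hB : ∀ n, L.l (B n) < ⊤) :
    L.hilbertSeries A B * (1 - PowerSeries.X) = L.hilbertSeries (rangeFamily x A B) B -
      L.hilbertSeries A (kerFamily x A B) * PowerSeries.X := by
  rw [mul_sub, mul_one]
  ext n
  cases n with
  | zero =>
    have h : rangeFamily x A B 0 = A 0 := rfl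
    simp only [hilbertSeries, map_sub, PowerSeries.coeff_mk, PowerSeries.coeff_zero_mul_X]
    rw [h]
  | succ n =>
    simp only [map_sub, PowerSeries.coeff_succ_mul_X, hilbertSeries, PowerSeries.coeff_mk]
    have h := L.l_add_eq_l_map_sup_add x (B n) (A (n + 1))
    have hD : L.l (rangeFamily x A B (n + 1)) < ⊤ :=
      (L.l_sup_le _ _).trans_lt
        (ENNReal.add_lt_top.2 ⟨(L.l_map_le _ _).trans_lt (hB n), hA (n + 1)⟩)
    have hK : L.l (kerFamily x A B n) < ⊤ := (L.l_mono inf_le_left).trans_lt (hB n)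
    change _ = L.l (rangeFamily x A B (n + 1)) + L.l (kerFamily x A B n) at h
    have h' := congrArg ENNReal.toReal h
    rw [ENNReal.toReal_add (hB n).ne (hA _).ne, ENNReal.toReal_add hD.ne hK.ne] at h'
    linarith

/-- The Hilbert–Serre theorem for length functions. -/
theorem exists_hilbertSeries_mul_eq (ops : List (Module.End R N)) (hops : ops.Pairwise Commute)
    {A B : ℕ → Submodule R N} (hA : A ∈ stableFamilies ops A B) (hB : B ∈ stableFamilies ops A B)
    (hfin : ∀ n, L.l (B n) < ⊤) (hwf : (stableFamilies ops A B).WellFoundedOn (· > ·)) :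
    ∃ p : Polynomial ℝ,
      L.hilbertSeries A B * (1 - PowerSeries.X) ^ ops.length = (p : PowerSeries ℝ) := by
  induction ops generalizing A B with
  | nil =>
    obtain ⟨m, hm⟩ := exists_forall_ge_eq_of_wellFoundedOn hA.2.1 hwf
    refine ⟨(L.hilbertSeries A B).trunc m, ?_⟩
    ext n
    rw [Polynomial.coeff_coe, PowerSeries.coeff_trunc]
    split_ifs with h
    · simp
    · have := hm n (not_lt.1 h)
      rw [List.length_nil, pow_zero, mul_one, hilbertSeries, PowerSeries.coeff_mk, this, sub_self]
  | cons x ops ih =>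
    rw [List.pairwise_cons] at hops
    have hK := kerFamily_mem hops.1 hA hB
    have hD := rangeFamily_mem hops.1 hA hB
    obtain ⟨p, hp⟩ := ih hops.2 (B := kerFamily x A B)
      ⟨le_rfl, hK.1, fun f hf => hA.2.2 f (by simp [hf])⟩ ⟨hK.1, le_rfl, hK.2.2⟩
      (fun n => (L.l_mono inf_le_left).trans_lt (hfin n))
      (hwf.subset (stableFamilies_kerFamily_subset))
    obtain ⟨q, hq⟩ := ih hops.2 (A := rangeFamily x A B) (B := B)
      ⟨le_rfl, hD.2.1, hD.2.2⟩ ⟨hD.2.1, le_rfl, fun f hf => hB.2.2 f (by simp [hf])⟩ hfin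
      (hwf.subset stableFamilies_rangeFamily_subset)
    refine ⟨q - p * Polynomial.X, ?_⟩
    rw [List.length_cons, pow_succ', ← mul_assoc, hilbertSeries_mul_one_sub_X L x
      (fun n => (L.l_mono (hA.2.1 n)).trans_lt (hfin n)) hfin, sub_mul, hq, mul_right_comm, hp]
    simp

end LengthFunction

section ReesAlgebra

open MvPolynomial

variable {R : Type} [CommRing R] {k : ℕ}

/-- The Rees algebra `⨁ₙ Sₙ tⁿ` of `S = R[x₁,…,x_k]` filtered by total degree. -/
noncomputable def degreeRees (R : Type) [CommRing R] (k : ℕ) :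
    Subalgebra R (Polynomial (MvPolynomial (Fin k) R)) :=
  Algebra.adjoin R (insert Polynomial.X (Set.range fun i => Polynomial.monomial 1 (X i)))

instance [IsNoetherianRing R] : IsNoetherianRing (degreeRees R k) :=
  isNoetherianRing_of_fg (Subalgebra.fg_def.2 ⟨_, (Set.finite_range _).insert _, rfl⟩)

theorem monomial_mem_degreeRees {n : ℕ} {p : MvPolynomial (Fin k) R}
    (hp : p ∈ restrictTotalDegree (Fin k) R n) : Polynomial.monomial n p ∈ degreeRees R k := by
  rw [mem_restrictTotalDegree] at hp
  rw [p.as_sum, map_sum]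
  refine sum_mem fun d hd => ?_
  have hdn : d.degree ≤ n := (le_totalDegree hd).trans hp
  have h : Polynomial.monomial n (monomial d (p.coeff d)) = p.coeff d •
      ((∏ i, (Polynomial.monomial 1 (X i : MvPolynomial (Fin k) R)) ^ d i) *
        Polynomial.X ^ (n - d.degree)) := by
    have h1 : ∀ i, Polynomial.monomial 1 (X i : MvPolynomial (Fin k) R) =
        Polynomial.C (X i) * Polynomial.X := fun i => by
      rw [← Polynomial.C_mul_X_eq_monomial]
    simp_rw [h1, mul_pow, Finset.prod_mul_distrib, Finset.prod_pow_eq_pow_sum]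
    rw [mul_assoc, ← pow_add, ← Finsupp.degree_eq_sum, Nat.add_sub_cancel' hdn,
      ← Polynomial.C_mul_X_pow_eq_monomial, monomial_eq, Finsupp.prod_fintype _ _ (by simp),
      Algebra.smul_def, ← mul_assoc]
    simp [map_prod, MvPolynomial.algebraMap_eq]
  rw [h]
  refine (degreeRees R k).smul_mem
    (mul_mem (Subalgebra.prod_mem _ fun i _ => pow_mem ?_ _) (pow_mem ?_ _)) _
  · exact Algebra.subset_adjoin (Or.inr ⟨i, rfl⟩)
  · exact Algebra.subset_adjoin (Or.inl rfl)

variable {N : Type} [AddCommGroup N] [Module R N] [Module (MvPolynomial (Fin k) R) N]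
  [IsScalarTower R (MvPolynomial (Fin k) R) N]

/-- The identity followed by multiplication by each of the variables. -/
noncomputable def degreeOps (R : Type) [CommRing R] (k : ℕ) (N : Type) [AddCommGroup N]
    [Module R N] [Module (MvPolynomial (Fin k) R) N] [IsScalarTower R (MvPolynomial (Fin k) R) N] :
    List (Module.End R N) :=
  1 :: List.ofFn fun i : Fin k => Algebra.lsmul R R N (X i : MvPolynomial (Fin k) R)

theorem pairwise_commute_degreeOps : (degreeOps R k N).Pairwise Commute := by
  refine List.pairwise_cons.2 ⟨fun _ _ => Commute.one_left _, List.pairwise_ofFn.2 fun i j _ => ?_⟩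
  exact (Commute.all (X i : MvPolynomial (Fin k) R) (X j)).map (Algebra.lsmul R R N)

theorem degSmul_mem_stableFamilies (V : Submodule R N) :
    (fun n => degSmul k n V) ∈ stableFamilies (degreeOps R k N) ⊥ (fun n => degSmul k n V) := by
  refine ⟨bot_le, le_rfl, fun f hf n => Submodule.span_le.2 ?_⟩
  rintro _ ⟨p, hp, v, hv, rfl⟩
  rw [mem_restrictTotalDegree] at hp
  simp only [degreeOps, List.mem_cons, List.mem_ofFn] at hf
  obtain rfl | ⟨i, rfl⟩ := hf
  · exact Submodule.subset_span ⟨p, (mem_restrictTotalDegree _ _ _).2 (hp.trans n.le_succ), v, hv,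
      rfl⟩
  · refine Submodule.subset_span ⟨X i * p, (mem_restrictTotalDegree _ _ _).2 ?_, v, hv,
      mul_smul _ _ _⟩
    calc _ ≤ (X i : MvPolynomial (Fin k) R).totalDegree + p.totalDegree := totalDegree_mul _ _
      _ ≤ 1 + n := add_le_add (by
        refine (totalDegree_monomial_le _ _).trans ?_
        simp) hp
      _ = n + 1 := add_comm _ _

theorem LengthFunction.l_degSmul_lt_top (L : LengthFunction R) {V : Submodule R N}
    (hV : L.l V < ⊤) (n : ℕ) : L.l (degSmul k n V) < ⊤ := by
  let P : (Fin k →₀ ℕ) → Submodule R N := fun d =>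
    V.map (Algebra.lsmul R R N (monomial d 1 : MvPolynomial (Fin k) R))
  let s := (Finsupp.finite_of_degree_le (σ := Fin k) n).toFinset
  refine (L.l_mono (Q := s.sup P) (Submodule.span_le.2 ?_)).trans_lt
    (L.l_finset_sup_lt_top s P fun d _ => (L.l_map_le _ _).trans_lt hV)
  rintro _ ⟨p, hp, v, hv, rfl⟩
  rw [mem_restrictTotalDegree] at hp
  rw [p.as_sum, Finset.sum_smul]
  refine sum_mem fun d hd => ?_
  have hds : d ∈ s := by
    exact (Set.Finite.mem_toFinset _).2 ((le_totalDegree hd).trans hp)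
  refine Finset.le_sup (f := P) hds ⟨p.coeff d • v, V.smul_mem _ hv, ?_⟩
  change (monomial d 1 : MvPolynomial (Fin k) R) • p.coeff d • v = _
  rw [smul_comm, ← smul_assoc, smul_monomial, smul_eq_mul, mul_one]

/-- The `Sₙ`-graded submodule of `N[t]` attached to a stable family of submodules of `N`. -/
noncomputable def gradedSubmodule (W : ℕ → Submodule R N)
    (hW : ∀ f ∈ degreeOps R k N, ∀ n, W n ≤ (W (n + 1)).comap f) :
    Submodule (degreeRees R k) (PolynomialModule (MvPolynomial (Fin k) R) N) where
  carrier := {g | ∀ n, g.coeff n ∈ W n}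
  add_mem' hf hg n := add_mem (hf n) (hg n)
  zero_mem' n := zero_mem _
  smul_mem' := by
    rintro ⟨a, ha⟩ g hg
    change ∀ n, (a • g).coeff n ∈ W n
    induction ha using Algebra.adjoin_induction generalizing g with
    | mem a ha =>
      have key : ∀ s : MvPolynomial (Fin k) R, (Algebra.lsmul R R N s) ∈ degreeOps R k N →
          ∀ n, (Polynomial.monomial 1 s • g).coeff n ∈ W n := fun s hs n => by
        rw [PolynomialModule.monomial_smul_apply]
        split_ifs with h
        · obtain ⟨n, rfl⟩ := Nat.exists_eq_add_of_le' h
          exact hW _ hs n (hg n)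
        · exact zero_mem _
      obtain rfl | ⟨i, rfl⟩ := ha
      · exact key 1 (by simp [degreeOps])
      · exact key (X i) (by simp [degreeOps])
    | algebraMap r =>
      intro n
      rw [algebraMap_smul]
      exact (W n).smul_mem r (hg n)
    | add a b _ _ iha ihb =>
      intro n
      rw [add_smul]
      exact add_mem (iha hg n) (ihb hg n)
    | mul a b _ _ iha ihb =>
      rw [mul_smul]
      exact iha (ihb hg)

theorem wellFoundedOn_stableFamilies_degSmul [IsNoetherianRing R] {V : Submodule R N} (hV : V.FG) :
    (stableFamilies (degreeOps R k N) ⊥ (fun n => degSmul k n V)).WellFoundedOn (· > ·) := by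
  obtain ⟨s, rfl⟩ := hV
  set V := Submodule.span R (s : Set N)
  let G : Submodule (degreeRees R k) (PolynomialModule (MvPolynomial (Fin k) R) N) :=
    Submodule.span _ (PolynomialModule.single _ 0 '' (s : Set N))
  have : IsNoetherian (degreeRees R k) G :=
    @isNoetherian_of_fg_of_noetherian (degreeRees R k) _ _ _ _ G inferInstance
      (Submodule.fg_span (s.finite_toSet.image _))
  have hr : ∀ n (r : R) (v : N), PolynomialModule.single (MvPolynomial (Fin k) R) n v ∈ G →
      PolynomialModule.single (MvPolynomial (Fin k) R) n (r • v) ∈ G := fun n r v hv => by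
    have h := G.smul_mem (algebraMap R (degreeRees R k) r) hv
    rw [algebraMap_smul] at h
    convert h using 1
    exact PolynomialModule.ext (Finsupp.smul_single r n v).symm
  have hG₀ : ∀ v ∈ V, PolynomialModule.single (MvPolynomial (Fin k) R) 0 v ∈ G := by
    intro v hv
    induction hv using Submodule.span_induction with
    | mem v hv => exact Submodule.subset_span ⟨v, hv, rfl⟩
    | zero => simp
    | add v w _ _ hv hw => rw [PolynomialModule.single_add]; exact add_mem hv hw
    | smul r v _ hv => exact hr _ r v hv
  have hG : ∀ n, ∀ v ∈ degSmul k n V, PolynomialModule.single (MvPolynomial (Fin k) R) n v ∈ G := by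
    intro n v hv
    induction hv using Submodule.span_induction with
    | mem v hv =>
      obtain ⟨p, hp, v, hv, rfl⟩ := hv
      have h := G.smul_mem ⟨_, monomial_mem_degreeRees hp⟩ (hG₀ v hv)
      change Polynomial.monomial n p • _ ∈ G at h
      rwa [PolynomialModule.monomial_smul_single, add_zero] at h
    | zero => simp
    | add v w _ _ hv hw => rw [PolynomialModule.single_add]; exact add_mem hv hw
    | smul r v _ hv => exact hr _ r v hv
  let U : stableFamilies (degreeOps R k N) ⊥ (fun n => degSmul k n V) →
      Submodule (degreeRees R k) G := fun W => (gradedSubmodule W.1 W.2.2.2).comap G.subtype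
  refine Subrelation.wf (r := InvImage (· > ·) U) ?_ (InvImage.wf U wellFounded_gt)
  intro W W' h
  refine lt_of_le_not_ge (fun g hg n => h.le n (hg n)) fun hle => h.not_ge fun n w hw => ?_
  have := @hle ⟨PolynomialModule.single _ n w, hG n w (W.2.2.1 n hw)⟩ (fun m => by
    change (Finsupp.single n w) m ∈ W.1 m
    rw [Finsupp.single_apply]
    split_ifs with hnm
    · exact hnm ▸ hw
    · exact zero_mem _) n
  simpa using this

end ReesAlgebra

/-- Let `R` be a Noetherian commutative ring, `λ` a length function on `R`-modules,
`S = R[x₁,…,x_k]`, `N` an `S`-module, and `V₀ ≤ N` an `R`-submodule which is finitely generated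
as an `R`-module and has `λ(V₀) < ∞`.  Then `λ(Sₙ · V₀) < ∞` for every `n`, and there is a
polynomial `p(t) ∈ ℝ[t]` with `Σₙ λ(Sₙ · V₀) tⁿ = p(t)/(1-t)^{k+1}` in `ℝ[[t]]`
(equivalently, `(Σₙ λ(Sₙ·V₀) tⁿ) · (1-t)^{k+1} = p(t)`, the denominator being a unit). -/
theorem stmt_9 {R : Type} [CommRing R] [IsNoetherianRing R] {k : ℕ} (L : LengthFunction R)
    {N : Type} [AddCommGroup N] [Module R N]
    [Module (MvPolynomial (Fin k) R) N] [IsScalarTower R (MvPolynomial (Fin k) R) N]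
    (V₀ : Submodule R N) (hV₀fg : V₀.FG) (hV₀fin : L.l V₀ < ⊤) :
    (∀ n : ℕ, L.l (degSmul k n V₀) < ⊤) ∧
    ∃ p : Polynomial ℝ,
      (PowerSeries.mk fun n => (L.l (degSmul k n V₀)).toReal) *
          (1 - (PowerSeries.X : PowerSeries ℝ)) ^ (k + 1) =
        (p : PowerSeries ℝ) := by
  have hfin := L.l_degSmul_lt_top (k := k) hV₀fin
  refine ⟨hfin, ?_⟩
  have hmem := degSmul_mem_stableFamilies (k := k) V₀
  obtain ⟨p, hp⟩ := L.exists_hilbertSeries_mul_eq (degreeOps R k N) pairwise_commute_degreeOps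
    (A := ⊥) (B := fun n => degSmul k n V₀) ⟨le_rfl, bot_le, fun _ _ _ => bot_le⟩ hmem hfin
    (wellFoundedOn_stableFamilies_degSmul hV₀fg)
  refine ⟨p, ?_⟩
  rw [← hp]
  congr 2
  · simp [L.l_zero (⊥ : Submodule R N) inferInstance]
  · simp [degreeOps]
end

section
/- Let R be a Noetherian commutative ring with unity, λ a length function on R-modules, S = R[x₁,…,x_k], N an S-module, and V₀ ≤ N a finitely generated R-submodule with λ(V₀) < ∞. Then there is a polynomial q_{V₀}(t) ∈ ℝ[t] of degree at most k with λ(Sₙ·V₀) = q_{V₀}(n) for all sufficiently large n. If moreover S·V₀ = N and V₀' is another finitely generated R-submodule of N with λ(V₀') < ∞ and S·V₀' = N, then there is n₀ ∈ ℕ with q_{V₀'}(t) ≤ q_{V₀}(t + n₀) for large t; consequently q_{V₀} and q_{V₀'} have the same leading coefficient, so this leading coefficient μ_λ(N) is an invariant of N independent of the choice of V₀. -/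
open scoped ENNReal

open Filter in
/-- `f` agrees for large arguments with a real polynomial of degree at most `k`. -/
def EventuallyPoly (k : ℕ) (f : ℕ → ℝ) : Prop :=
  ∃ q : Polynomial ℝ, q.natDegree ≤ k ∧ ∀ᶠ n : ℕ in atTop, f n = q.eval (n : ℝ)

namespace EventuallyPoly

open Filter Polynomial

theorem const (k : ℕ) (c : ℝ) : EventuallyPoly k fun _ => c :=
  ⟨C c, by simp, by simp⟩

theorem mono {k l : ℕ} {f : ℕ → ℝ} (h : EventuallyPoly k f) (hkl : k ≤ l) :
    EventuallyPoly l f :=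
  let ⟨q, hq, hf⟩ := h
  ⟨q, hq.trans hkl, hf⟩

theorem congr {k : ℕ} {f g : ℕ → ℝ} (h : EventuallyPoly k f) (hfg : f =ᶠ[atTop] g) :
    EventuallyPoly k g := by
  obtain ⟨q, hq, hf⟩ := h
  refine ⟨q, hq, ?_⟩
  filter_upwards [hf, hfg] with n h1 h2
  rw [← h2, h1]

theorem add {k : ℕ} {f g : ℕ → ℝ} (hf : EventuallyPoly k f) (hg : EventuallyPoly k g) :
    EventuallyPoly k fun n => f n + g n := by
  obtain ⟨p, hp, hf⟩ := hf
  obtain ⟨q, hq, hg⟩ := hg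
  refine ⟨p + q, natDegree_add_le_of_degree_le hp hq, ?_⟩
  filter_upwards [hf, hg] with n h1 h2
  rw [h1, h2, eval_add]

theorem finset_sum {ι : Type*} {k : ℕ} (s : Finset ι) {f : ι → ℕ → ℝ}
    (h : ∀ i ∈ s, EventuallyPoly k (f i)) : EventuallyPoly k fun n => ∑ i ∈ s, f i n := by
  classical
  induction s using Finset.induction_on with
  | empty => simpa using const k 0
  | insert a s ha ih =>
    simp only [Finset.sum_insert ha]
    exact (h a (by simp)).add (ih fun i hi => h i (by simp [hi]))

theorem comp_sub {k : ℕ} {f : ℕ → ℝ} (h : EventuallyPoly k f) (a : ℕ) :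
    EventuallyPoly k fun n => f (n - a) := by
  obtain ⟨q, hq, hf⟩ := h
  refine ⟨q.comp (X - C (a : ℝ)), by
    rwa [natDegree_comp, natDegree_X_sub_C, mul_one], ?_⟩
  filter_upwards [(tendsto_sub_atTop_nat a).eventually hf, eventually_ge_atTop a] with n h1 h2
  rw [h1]
  simp [Nat.cast_sub h2]

theorem sum_range_pow (p : ℕ) :
    EventuallyPoly (p + 1) fun n => ∑ i ∈ Finset.range n, (i : ℝ) ^ p := by
  refine ⟨∑ i ∈ Finset.range (p + 1),
    C ((_root_.bernoulli i * ((p + 1).choose i) / (p + 1) : ℚ) : ℝ) * X ^ (p + 1 - i), ?_, ?_⟩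
  · refine natDegree_sum_le_of_forall_le _ _ fun i _ => ?_
    exact (natDegree_C_mul_X_pow_le _ _).trans (Nat.sub_le _ _)
  · refine Eventually.of_forall fun n => ?_
    have h := congrArg (fun x : ℚ => (x : ℝ)) (_root_.sum_range_pow n p)
    push_cast at h
    simp only [h, eval_finsetSum]
    refine Finset.sum_congr rfl fun i _ => ?_
    simp only [eval_mul, eval_C, eval_pow, eval_X]
    push_cast
    ring

theorem sum_range {k : ℕ} {f : ℕ → ℝ} (h : EventuallyPoly k f) :
    EventuallyPoly (k + 1) fun n => ∑ i ∈ Finset.range n, f i := by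
  obtain ⟨q, hq, hf⟩ := h
  obtain ⟨m, hm⟩ := eventually_atTop.1 hf
  have hpoly : EventuallyPoly (k + 1) fun n => ∑ i ∈ Finset.range n, q.eval (i : ℝ) := by
    have : EventuallyPoly (k + 1) fun n => ∑ j ∈ Finset.range (k + 1),
        q.coeff j * ∑ i ∈ Finset.range n, (i : ℝ) ^ j := by
      refine finset_sum _ fun j hj => ?_
      obtain ⟨r, hr, hfr⟩ := sum_range_pow j
      refine ⟨C (q.coeff j) * r, (natDegree_C_mul_le _ _).trans
        (hr.trans (by simpa using Finset.mem_range_succ_iff.1 hj)), ?_⟩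
      filter_upwards [hfr] with n hn
      rw [hn, eval_mul, eval_C]
    refine this.congr (Eventually.of_forall fun n => ?_)
    simp only [Finset.mul_sum]
    rw [Finset.sum_comm]
    refine Finset.sum_congr rfl fun i _ => ?_
    rw [eval_eq_sum_range' (Nat.lt_succ_of_le hq)]
  refine ((const _ (∑ i ∈ Finset.range m, (f i - q.eval (i : ℝ)))).add hpoly).congr ?_
  filter_upwards [eventually_ge_atTop m] with n hn
  rw [← eq_sub_iff_add_eq, ← Finset.sum_sub_distrib]
  refine Finset.sum_subset (Finset.range_subset_range.2 hn) fun i _ hi => ?_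
  rw [hm i (by simpa using hi), sub_self]

/-- A sum along an antidiagonal is eventually polynomial if the summands stabilize in the first
index. -/
theorem sum_range_succ_sub {k : ℕ} {H : ℕ → ℕ → ℝ} (h : ∀ a, EventuallyPoly k (H a)) (A : ℕ)
    (hA : ∀ a, A ≤ a → H a = H A) :
    EventuallyPoly (k + 1) fun n => ∑ a ∈ Finset.range (n + 1), H a (n - a) := by
  have h1 : EventuallyPoly (k + 1) fun n => ∑ a ∈ Finset.range (A + 1), H a (n - a) :=
    finset_sum _ fun a _ => ((h a).comp_sub a).mono k.le_succ
  refine (h1.add ((h A).sum_range.comp_sub A)).congr ?_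
  filter_upwards [eventually_ge_atTop A] with n hn
  obtain ⟨m, rfl⟩ := Nat.exists_eq_add_of_le hn
  rw [show A + m + 1 = A + 1 + m by ring, Finset.sum_range_add _ (A + 1) m,
    Nat.add_sub_cancel_left, ← Finset.sum_range_reflect (H A)]
  congr 1
  refine Finset.sum_congr rfl fun i _ => ?_
  rw [hA (A + 1 + i) (by omega)]
  congr 1
  omega

end EventuallyPoly

/-- The exponent vectors of total degree at most `n`. -/
def degreeLE (k n : ℕ) : Finset (Fin k → ℕ) :=
  (Fintype.piFinset fun _ => Finset.range (n + 1)).filter fun a => ∑ i, a i ≤ n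

theorem mem_degreeLE {k n : ℕ} {a : Fin k → ℕ} : a ∈ degreeLE k n ↔ ∑ i, a i ≤ n := by
  simp only [degreeLE, Finset.mem_filter, Fintype.mem_piFinset, Finset.mem_range,
    and_iff_right_iff_imp]
  exact fun h i => Nat.lt_succ_of_le
    ((Finset.single_le_sum (fun _ _ => Nat.zero_le _) (Finset.mem_univ i)).trans h)

theorem sum_degreeLE_succ {M : Type*} [AddCommMonoid M] (k n : ℕ) (f : (Fin (k + 1) → ℕ) → M) :
    ∑ a ∈ degreeLE (k + 1) n, f a =
      ∑ a ∈ Finset.range (n + 1), ∑ b ∈ degreeLE k (n - a), f (Fin.cons a b) := by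
  rw [Finset.sum_sigma']
  refine Finset.sum_bij' (fun a _ => ⟨a 0, Fin.tail a⟩) (fun x _ => Fin.cons x.1 x.2)
    ?_ ?_ ?_ ?_ ?_
  · intro a ha
    rw [mem_degreeLE, Fin.sum_univ_succ] at ha
    simp only [Finset.mem_sigma, Finset.mem_range, mem_degreeLE, Fin.tail]
    omega
  · rintro ⟨a, b⟩ hab
    simp only [Finset.mem_sigma, Finset.mem_range, mem_degreeLE] at hab
    rw [mem_degreeLE, Fin.sum_univ_succ]
    simp only [Fin.cons_zero, Fin.cons_succ]
    omega
  · intro a _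
    exact Fin.cons_self_tail a
  · rintro ⟨a, b⟩ _
    simp
  · intro a _
    simp

/-- An increasing sequence of monotone maps from a well quasi-order to a Noetherian order
stabilizes. -/
theorem exists_forall_ge_eq_of_monotone {α P : Type*} [Preorder α] [WellQuasiOrderedLE α]
    [PartialOrder P] [WellFoundedGT P] {J : ℕ → α → P} (h₁ : Monotone J)
    (h₂ : ∀ a, Monotone (J a)) : ∃ A, ∀ a, A ≤ a → J a = J A := by
  by_contra! hcon
  choose next hle hne using hcon
  have hlt (A : ℕ) : ∃ b, J A b < J (next A) b := by
    by_contra! hb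
    exact hne A (le_antisymm (fun b => by
      by_contra hnb
      exact hb b (lt_of_le_not_ge (h₁ (hle A) b) hnb)) (h₁ (hle A)))
  choose b hb using hlt
  let s : ℕ → ℕ := fun n => next^[n] 0
  have hs (n : ℕ) : s (n + 1) = next (s n) := Function.iterate_succ_apply' next n 0
  have hsm : Monotone s := monotone_nat_of_le_succ fun n => (hs n).symm ▸ hle (s n)
  obtain ⟨g, hg⟩ := (wellQuasiOrdered_le (α := α)).exists_monotone_subseq fun n => b (s n)
  refine not_strictMono_of_wellFoundedGT (fun i => J (s (g i)) (b (s (g i))))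
    (strictMono_nat_of_lt_succ fun i => ?_)
  calc J (s (g i)) (b (s (g i))) < J (s (g i + 1)) (b (s (g i))) := (hs _).symm ▸ hb _
    _ ≤ J (s (g (i + 1))) (b (s (g i))) := h₁ (hsm (g.strictMono i.lt_succ_self)) _
    _ ≤ J (s (g (i + 1))) (b (s (g (i + 1)))) := h₂ _ (hg i (i + 1) i.le_succ)

/-- The cumulative Hilbert function of a monotone family indexed by `ℕᵏ` with values in a
Noetherian order is eventually polynomial of degree at most `k`. -/
theorem eventuallyPoly_sum_degreeLE {P : Type*} [PartialOrder P] [WellFoundedGT P] (f : P → ℝ)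
    (k : ℕ) {J : (Fin k → ℕ) → P} (hJ : Monotone J) :
    EventuallyPoly k fun n => ∑ a ∈ degreeLE k n, f (J a) := by
  induction k with
  | zero =>
    refine (EventuallyPoly.const 0 (f (J 0))).congr (Filter.Eventually.of_forall fun n => ?_)
    have : degreeLE 0 n = {0} := by
      ext a
      simp [mem_degreeLE, Subsingleton.elim a 0]
    simp [this]
  | succ k ih =>
    have hcons {a a' : ℕ} {b b' : Fin k → ℕ} (ha : a ≤ a') (hb : b ≤ b') :
        J (Fin.cons a b) ≤ J (Fin.cons a' b') := hJ (Fin.cons_le_cons.2 ⟨ha, hb⟩)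
    obtain ⟨A, hA⟩ := exists_forall_ge_eq_of_monotone (J := fun a b => J (Fin.cons a b))
      (fun _ _ h _ => hcons h le_rfl) (fun _ _ _ h => hcons le_rfl h)
    simp only [sum_degreeLE_succ]
    refine EventuallyPoly.sum_range_succ_sub
      (H := fun a n => ∑ b ∈ degreeLE k n, f (J (Fin.cons a b)))
      (fun a => ih (fun _ _ h => hcons le_rfl h)) A fun a ha => ?_
    funext n
    exact Finset.sum_congr rfl fun b _ => congrArg f (congrFun (hA a ha) b)

section LeadingCoeff

open Filter Polynomial

theorem Polynomial.leadingCoeff_nonneg_of_eventually {p : ℝ[X]}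
    (h : ∀ᶠ n : ℕ in atTop, 0 ≤ p.eval (n : ℝ)) : 0 ≤ p.leadingCoeff := by
  by_contra! hneg
  rcases Nat.eq_zero_or_pos p.natDegree with h0 | h0
  · rw [eq_C_of_natDegree_eq_zero h0] at h hneg
    obtain ⟨n, hn⟩ := h.exists
    simp only [eval_C, leadingCoeff_C] at hn hneg
    linarith
  · have ht := (tendsto_atBot_of_leadingCoeff_nonpos p (natDegree_pos_iff_degree_pos.1 h0)
      hneg.le).comp tendsto_natCast_atTop_atTop
    obtain ⟨n, hn, hn'⟩ := (h.and (ht.eventually_lt_atBot 0)).exists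
    exact absurd hn' (not_lt.2 hn)

theorem Polynomial.natDegree_le_of_leadingCoeff_sub_nonneg {p q : ℝ[X]} (hq : 0 ≤ q.leadingCoeff)
    (h : 0 ≤ (p - q).leadingCoeff) : q.natDegree ≤ p.natDegree := by
  by_contra! hlt
  rw [leadingCoeff_sub_of_degree_lt' (degree_lt_degree hlt)] at h
  have : q = 0 := leadingCoeff_eq_zero.1 (by linarith)
  simp [this] at hlt

theorem Polynomial.leadingCoeff_le_of_leadingCoeff_sub_nonneg {p q : ℝ[X]}
    (hd : q.natDegree = p.natDegree) (h : 0 ≤ (p - q).leadingCoeff) :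
    q.leadingCoeff ≤ p.leadingCoeff := by
  have hle : (p - q).natDegree ≤ p.natDegree :=
    (natDegree_sub_le _ _).trans (by simp [hd])
  have hc : (p - q).coeff p.natDegree = p.leadingCoeff - q.leadingCoeff := by
    rw [coeff_sub, ← hd, coeff_natDegree, hd, coeff_natDegree]
  rcases hle.eq_or_lt with he | hlt
  · rw [← he, coeff_natDegree] at hc
    linarith
  · rw [coeff_eq_zero_of_natDegree_lt hlt] at hc
    linarith

/-- Two eventually nonnegative polynomials, each eventually bounded by a shift of the other, have
the same leading coefficient. -/
theorem Polynomial.leadingCoeff_eq_of_eventually_le_shift {p q : ℝ[X]} {a b : ℕ}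
    (hp : ∀ᶠ n : ℕ in atTop, 0 ≤ p.eval (n : ℝ)) (hq : ∀ᶠ n : ℕ in atTop, 0 ≤ q.eval (n : ℝ))
    (hqp : ∀ᶠ n : ℕ in atTop, q.eval (n : ℝ) ≤ p.eval ((n + a : ℕ) : ℝ))
    (hpq : ∀ᶠ n : ℕ in atTop, p.eval (n : ℝ) ≤ q.eval ((n + b : ℕ) : ℝ)) :
    p.leadingCoeff = q.leadingCoeff := by
  have hdeg (r : ℝ[X]) (c : ℕ) : (r.comp (X + C (c : ℝ))).natDegree = r.natDegree := by
    rw [natDegree_comp, natDegree_X_add_C, mul_one]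
  have hlc (r : ℝ[X]) (c : ℕ) : (r.comp (X + C (c : ℝ))).leadingCoeff = r.leadingCoeff := by
    rw [leadingCoeff_comp (by rw [natDegree_X_add_C]; exact one_ne_zero),
      leadingCoeff_X_add_C, one_pow, mul_one]
  have hsub {r s : ℝ[X]} {c : ℕ}
      (h : ∀ᶠ n : ℕ in atTop, r.eval (n : ℝ) ≤ s.eval ((n + c : ℕ) : ℝ)) :
      0 ≤ (s.comp (X + C (c : ℝ)) - r).leadingCoeff := by
    refine leadingCoeff_nonneg_of_eventually ?_
    filter_upwards [h] with n hn
    simpa using hn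
  have h1 := natDegree_le_of_leadingCoeff_sub_nonneg (leadingCoeff_nonneg_of_eventually hq)
    (hsub hqp)
  have h2 := natDegree_le_of_leadingCoeff_sub_nonneg (leadingCoeff_nonneg_of_eventually hp)
    (hsub hpq)
  rw [hdeg] at h1 h2
  have hd := le_antisymm h1 h2
  have h3 := leadingCoeff_le_of_leadingCoeff_sub_nonneg (by rw [hdeg, hd]) (hsub hqp)
  have h4 := leadingCoeff_le_of_leadingCoeff_sub_nonneg (by rw [hdeg, hd]) (hsub hpq)
  rw [hlc] at h3 h4
  exact le_antisymm h4 h3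

end LeadingCoeff

namespace LengthFunction

variable {R : Type} [CommRing R] (L : LengthFunction R) {M : Type} [AddCommGroup M] [Module R M]

theorem l_le_of_le {A B : Submodule R M} (h : A ≤ B) : L.l A ≤ L.l B := by
  rw [L.l_add B (A.submoduleOf B), L.l_congr _ _ (Submodule.submoduleOfEquivOfLe h)]
  exact le_self_add

theorem l_quotient_le (A : Submodule R M) : L.l (M ⧸ A) ≤ L.l M := by
  rw [L.l_add M A]
  exact le_add_self

theorem l_sup_map (W V : Submodule R M) (T : M →ₗ[R] M) :
    L.l (W ⊔ V.map T : Submodule R M) = L.l W + L.l (V ⧸ W.comap (T ∘ₗ V.subtype)) := by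
  let B := W ⊔ V.map T
  let f : V →ₗ[R] B := (T ∘ₗ V.subtype).codRestrict B fun v =>
    Submodule.mem_sup_right (Submodule.mem_map_of_mem v.2)
  let g : V →ₗ[R] B ⧸ W.submoduleOf B := (W.submoduleOf B).mkQ ∘ₗ f
  have hg : Function.Surjective g := by
    intro x
    obtain ⟨⟨y, hy⟩, rfl⟩ := Submodule.mkQ_surjective _ x
    obtain ⟨w, hw, _, ⟨v, hv, rfl⟩, rfl⟩ := Submodule.mem_sup.1 hy
    refine ⟨⟨v, hv⟩, ?_⟩
    refine (Submodule.Quotient.eq _).2 ?_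
    simpa [f, Submodule.submoduleOf] using W.neg_mem hw
  have hker : LinearMap.ker g = W.comap (T ∘ₗ V.subtype) := by
    rw [LinearMap.ker_comp, Submodule.ker_mkQ]
    rfl
  rw [L.l_add B (W.submoduleOf B), L.l_congr _ _ (Submodule.submoduleOfEquivOfLe le_sup_left),
    ← L.l_congr _ _ (g.quotKerEquivOfSurjective hg),
    L.l_congr _ _ (Submodule.quotEquivOfEq _ _ hker)]

/-- Additivity of a length function along the filtration of `⨆ d ∈ s, T d V` by the initial
segments of `s`. -/
theorem l_biSup_map {ι : Type*} [LinearOrder ι] (V : Submodule R M) (T : ι → M →ₗ[R] M)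
    (s : Finset ι) (hs : IsLowerSet (s : Set ι)) :
    L.l (⨆ d ∈ s, V.map (T d) : Submodule R M) =
      ∑ d ∈ s, L.l (V ⧸ (⨆ e, ⨆ _ : e < d, V.map (T e)).comap (T d ∘ₗ V.subtype)) := by
  induction s using Finset.induction_on_max with
  | empty =>
    rw [Finset.sum_empty]
    exact L.l_zero _ (Submodule.subsingleton_iff_eq_bot.2 (by simp))
  | insert a s ha ih =>
    have hmem (e : ι) : e ∈ s ↔ e < a := by
      refine ⟨ha e, fun he => ?_⟩
      have := hs he.le (by simp : a ∈ ((insert a s : Finset ι) : Set ι))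
      simpa [he.ne] using this
    have hlow : IsLowerSet (s : Set ι) := fun x y hyx hx => by
      rw [Finset.mem_coe, hmem] at hx ⊢
      exact hyx.trans_lt hx
    have hW : (⨆ e, ⨆ _ : e < a, V.map (T e)) = ⨆ e ∈ s, V.map (T e) := by
      simp only [hmem]
    rw [Finset.sum_insert fun h => (ha a h).false, Finset.iSup_insert, sup_comm, l_sup_map, hW,
      ih hlow, add_comm]

end LengthFunction

section DegSmul

open MvPolynomial

variable {R : Type} [CommRing R] {k : ℕ} {N : Type} [AddCommGroup N] [Module R N]
  [Module (MvPolynomial (Fin k) R) N] [IsScalarTower R (MvPolynomial (Fin k) R) N]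

/-- Multiplication by the monomial with exponent vector `d`. -/
noncomputable def monomialSmul (R : Type) [CommRing R] {k : ℕ} (N : Type) [AddCommGroup N]
    [Module R N] [Module (MvPolynomial (Fin k) R) N]
    [IsScalarTower R (MvPolynomial (Fin k) R) N] (d : DegLex (Fin k →₀ ℕ)) : N →ₗ[R] N :=
  Algebra.lsmul R R N (monomial (ofDegLex d) (1 : R))

theorem monomialSmul_apply (d : DegLex (Fin k →₀ ℕ)) (x : N) :
    monomialSmul R N d x = monomial (ofDegLex d) (1 : R) • x := rfl

theorem monomialSmul_add (d e : DegLex (Fin k →₀ ℕ)) :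
    monomialSmul R N (d + e) = monomialSmul R N d ∘ₗ monomialSmul R N e := by
  ext x
  simp [monomialSmul_apply, ofDegLex_add, smul_smul, monomial_mul]

theorem smul_mem_degSmul {n : ℕ} {V : Submodule R N} {p : MvPolynomial (Fin k) R}
    (hp : p.totalDegree ≤ n) {v : N} (hv : v ∈ V) : p • v ∈ degSmul k n V :=
  Submodule.subset_span ⟨p, (mem_restrictTotalDegree _ _ _).2 hp, v, hv, rfl⟩

theorem degSmul_le {n : ℕ} {V W : Submodule R N}
    (h : ∀ p : MvPolynomial (Fin k) R, p.totalDegree ≤ n → ∀ v ∈ V, p • v ∈ W) :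
    degSmul k n V ≤ W := by
  refine Submodule.span_le.2 ?_
  rintro _ ⟨p, hp, v, hv, rfl⟩
  exact h p ((mem_restrictTotalDegree _ _ _).1 hp) v hv

theorem degSmul_mono {m n : ℕ} (hmn : m ≤ n) (V : Submodule R N) :
    degSmul k m V ≤ degSmul k n V :=
  degSmul_le fun _ hp _ hv => smul_mem_degSmul (hp.trans hmn) hv

theorem smul_mem_degSmul_add {m n : ℕ} {V : Submodule R N} {p : MvPolynomial (Fin k) R}
    (hp : p.totalDegree ≤ n) {x : N} (hx : x ∈ degSmul k m V) : p • x ∈ degSmul k (n + m) V := by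
  have : degSmul k m V ≤ (degSmul k (n + m) V).comap (Algebra.lsmul R R N p) :=
    degSmul_le fun r hr v hv => by
      change p • r • v ∈ degSmul k (n + m) V
      rw [smul_smul]
      exact smul_mem_degSmul ((totalDegree_mul _ _).trans (add_le_add hp hr)) hv
  exact this hx

theorem degSmul_le_degSmul_add {m : ℕ} {V V' : Submodule R N} (h : V' ≤ degSmul k m V) (n : ℕ) :
    degSmul k n V' ≤ degSmul k (n + m) V :=
  degSmul_le fun _ hp _ hv => smul_mem_degSmul_add hp (h hv)

theorem exists_mem_degSmul {V : Submodule R N}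
    (hV : Submodule.span (MvPolynomial (Fin k) R) (V : Set N) = ⊤) (x : N) :
    ∃ n, x ∈ degSmul k n V := by
  have hx : x ∈ Submodule.span (MvPolynomial (Fin k) R) (V : Set N) := hV ▸ Submodule.mem_top
  induction hx using Submodule.span_induction with
  | mem x hx => exact ⟨0, by simpa using smul_mem_degSmul (p := 1) (by simp) hx⟩
  | zero => exact ⟨0, zero_mem _⟩
  | add x y _ _ hx hy =>
    obtain ⟨m, hm⟩ := hx
    obtain ⟨n, hn⟩ := hy
    exact ⟨max m n, add_mem (degSmul_mono (le_max_left _ _) V hm)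
      (degSmul_mono (le_max_right _ _) V hn)⟩
  | smul p x _ hx =>
    obtain ⟨m, hm⟩ := hx
    exact ⟨_, smul_mem_degSmul_add le_rfl hm⟩

theorem exists_le_degSmul {V V' : Submodule R N}
    (hV : Submodule.span (MvPolynomial (Fin k) R) (V : Set N) = ⊤) (hV' : V'.FG) :
    ∃ n, V' ≤ degSmul k n V := by
  obtain ⟨s, rfl⟩ := hV'
  choose f hf using exists_mem_degSmul hV
  exact ⟨s.sup f, Submodule.span_le.2 fun x hx => degSmul_mono (Finset.le_sup hx) V (hf x)⟩

/-- Exponent vectors, ordered degree-lexicographically. -/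
noncomputable def toDegLexFinsupp (k : ℕ) : (Fin k → ℕ) ≃ DegLex (Fin k →₀ ℕ) :=
  Finsupp.equivFunOnFinite.symm.trans toDegLex

theorem toDegLexFinsupp_add (a b : Fin k → ℕ) :
    toDegLexFinsupp k (a + b) = toDegLexFinsupp k a + toDegLexFinsupp k b := by
  refine congrArg toDegLex (Finsupp.ext fun i => ?_)
  rfl

theorem mem_map_toDegLexFinsupp {n : ℕ} {d : DegLex (Fin k →₀ ℕ)} :
    d ∈ (degreeLE k n).map (toDegLexFinsupp k).toEmbedding ↔ (ofDegLex d).degree ≤ n := by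
  rw [Finset.mem_map_equiv, mem_degreeLE, Finsupp.degree_eq_sum]
  rfl

theorem degSmul_eq_biSup (n : ℕ) (V : Submodule R N) :
    degSmul k n V =
      ⨆ d ∈ (degreeLE k n).map (toDegLexFinsupp k).toEmbedding, V.map (monomialSmul R N d) := by
  refine le_antisymm (degSmul_le fun p hp v hv => ?_) (iSup₂_le fun d hd => ?_)
  · rw [p.as_sum, Finset.sum_smul]
    refine sum_mem fun d hd => ?_
    have hd' : toDegLex d ∈ (degreeLE k n).map (toDegLexFinsupp k).toEmbedding :=
      mem_map_toDegLexFinsupp.2 ((le_totalDegree hd).trans hp)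
    refine Submodule.mem_iSup_of_mem (toDegLex d) (Submodule.mem_iSup_of_mem hd'
      ⟨p.coeff d • v, V.smul_mem _ hv, ?_⟩)
    rw [map_smul, monomialSmul_apply, ← smul_assoc, smul_monomial, smul_eq_mul, mul_one,
      ofDegLex_toDegLex]
  · rw [Submodule.map_le_iff_le_comap]
    exact fun v hv => smul_mem_degSmul
      ((totalDegree_monomial_le _ _).trans (mem_map_toDegLexFinsupp.1 hd)) hv

/-- The elements `v` of `V` whose multiple `x ^ a • v` lies in the span of the `x ^ b • V` with
`b < a` in the degree-lexicographic order. -/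
noncomputable def leadingSubmodule (V : Submodule R N) (a : Fin k → ℕ) : Submodule R V :=
  (⨆ e, ⨆ _ : e < toDegLexFinsupp k a, V.map (monomialSmul R N e)).comap
    (monomialSmul R N (toDegLexFinsupp k a) ∘ₗ V.subtype)

theorem leadingSubmodule_mono (V : Submodule R N) :
    Monotone (leadingSubmodule (k := k) V) := by
  intro a b hab v hv
  obtain ⟨c, rfl⟩ := exists_add_of_le hab
  rw [add_comm]
  simp only [leadingSubmodule, Submodule.mem_comap, LinearMap.comp_apply, toDegLexFinsupp_add,
    monomialSmul_add] at hv ⊢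
  rw [← Submodule.mem_comap]
  refine SetLike.le_def.1 (iSup₂_le fun e he => ?_) hv
  rw [← Submodule.map_le_iff_le_comap, ← Submodule.map_comp, ← monomialSmul_add]
  exact le_iSup₂_of_le (toDegLexFinsupp k c + e) (by gcongr) le_rfl

theorem LengthFunction.l_degSmul (L : LengthFunction R) (n : ℕ) (V : Submodule R N) :
    L.l (degSmul k n V) = ∑ a ∈ degreeLE k n, L.l (V ⧸ leadingSubmodule V a) := by
  rw [degSmul_eq_biSup, L.l_biSup_map, Finset.sum_map]
  · rfl
  · intro d e hed hd
    rw [Finset.mem_coe, mem_map_toDegLexFinsupp] at hd ⊢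
    exact (Finsupp.DegLex.monotone_degree hed).trans hd

theorem LengthFunction.l_degSmul_ne_top (L : LengthFunction R) (n : ℕ) {V : Submodule R N}
    (hV : L.l V < ⊤) : L.l (degSmul k n V) ≠ ⊤ := by
  rw [L.l_degSmul]
  exact ENNReal.sum_ne_top.2 fun a _ => ((L.l_quotient_le _).trans_lt hV).ne

end DegSmul

open Filter in
/-- Hilbert polynomial: Let `R` be a Noetherian commutative ring, `λ` a length
function on `R`-modules, `S = R[x₁,…,x_k]`, `N` an `S`-module, and `V₀ ≤ N` a finitely generated
`R`-submodule with `λ(V₀) < ∞`.  Then there is a polynomial `q_{V₀} ∈ ℝ[t]` of degree at most `k`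
with `λ(Sₙ·V₀) = q_{V₀}(n)` for all large `n`.  If moreover `S·V₀ = N` and `V₀'` is another
finitely generated `R`-submodule with `λ(V₀') < ∞` and `S·V₀' = N`, then there is `n₀ ∈ ℕ` with
`q_{V₀'}(n) ≤ q_{V₀}(n + n₀)` for all large `n`, and consequently `q_{V₀}` and `q_{V₀'}` have the
same leading coefficient (so the leading coefficient `μ_λ(N)` does not depend on `V₀`). -/
theorem stmt_10 {R : Type} [CommRing R] [IsNoetherianRing R] {k : ℕ} (L : LengthFunction R)
    {N : Type} [AddCommGroup N] [Module R N]
    [Module (MvPolynomial (Fin k) R) N] [IsScalarTower R (MvPolynomial (Fin k) R) N]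
    (V₀ : Submodule R N) (hV₀fg : V₀.FG) (hV₀fin : L.l V₀ < ⊤) :
    (∃ q : Polynomial ℝ, q.natDegree ≤ k ∧
      ∀ᶠ n : ℕ in atTop, (L.l (degSmul k n V₀)).toReal = q.eval (n : ℝ)) ∧
    (Submodule.span (MvPolynomial (Fin k) R) (V₀ : Set N) = ⊤ →
      ∀ V₀' : Submodule R N, V₀'.FG → L.l V₀' < ⊤ →
        Submodule.span (MvPolynomial (Fin k) R) (V₀' : Set N) = ⊤ →
        ∀ q q' : Polynomial ℝ,
          (∀ᶠ n : ℕ in atTop, (L.l (degSmul k n V₀)).toReal = q.eval (n : ℝ)) →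
          (∀ᶠ n : ℕ in atTop, (L.l (degSmul k n V₀')).toReal = q'.eval (n : ℝ)) →
          (∃ n₀ : ℕ, ∀ᶠ n : ℕ in atTop, q'.eval (n : ℝ) ≤ q.eval ((n + n₀ : ℕ) : ℝ)) ∧
            q.leadingCoeff = q'.leadingCoeff) := by
  refine ⟨?_, fun hV₀ V₀' hV₀'fg hV₀'fin hV₀' q q' hq hq' => ?_⟩
  · have := isNoetherian_of_fg_of_noetherian V₀ hV₀fg
    obtain ⟨q, hqk, hq⟩ := eventuallyPoly_sum_degreeLE (fun J : Submodule R V₀ =>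
      (L.l (V₀ ⧸ J)).toReal) k (leadingSubmodule_mono (k := k) V₀)
    refine ⟨q, hqk, hq.mono fun n hn => ?_⟩
    rw [L.l_degSmul, ENNReal.toReal_sum fun a _ => ((L.l_quotient_le _).trans_lt hV₀fin).ne]
    exact hn
  · have hle {V W : Submodule R N} {p r : Polynomial ℝ} {m : ℕ} (hW : L.l W < ⊤)
        (hVW : V ≤ degSmul k m W)
        (hp : ∀ᶠ n : ℕ in atTop, (L.l (degSmul k n V)).toReal = p.eval (n : ℝ))
        (hr : ∀ᶠ n : ℕ in atTop, (L.l (degSmul k n W)).toReal = r.eval (n : ℝ)) :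
        ∀ᶠ n : ℕ in atTop, p.eval (n : ℝ) ≤ r.eval ((n + m : ℕ) : ℝ) := by
      filter_upwards [hp, (tendsto_add_atTop_nat m).eventually hr] with n h1 h2
      rw [← h1, ← h2]
      exact ENNReal.toReal_mono (L.l_degSmul_ne_top _ hW)
        (L.l_le_of_le (degSmul_le_degSmul_add hVW n))
    obtain ⟨a, ha⟩ := exists_le_degSmul hV₀ hV₀'fg
    obtain ⟨b, hb⟩ := exists_le_degSmul hV₀' hV₀fg
    have hqq' := hle hV₀fin ha hq' hq
    exact ⟨⟨a, hqq'⟩, Polynomial.leadingCoeff_eq_of_eventually_le_shift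
      (hq.mono fun n hn => hn ▸ ENNReal.toReal_nonneg)
      (hq'.mono fun n hn => hn ▸ ENNReal.toReal_nonneg) hqq' (hle hV₀'fin hb hq hq')⟩
end

section
/- Let R be a Noetherian commutative ring with unity, λ a length function on R-modules, S = R[x₁,…,x_k], and let 0 → A → B → C → 0 be an exact sequence of S-modules with B λ_S-small. Then μ(B) = μ(A) ⊕ μ(C), where for monomials r·tⁿ ⊕ s·tᵐ := r·tⁿ if n > m, s·tᵐ if n < m, and (r+s)·tⁿ if n = m. -/
open scoped ENNReal

/-- The sum `r·tⁿ ⊕ s·tᵐ` of two monomials (represented as pairs (degree, coefficient)):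
it is `r·tⁿ` if `n > m`, `s·tᵐ` if `n < m`, and `(r+s)·tⁿ` if `n = m`. -/
def mOplus (a b : ℕ × ℝ) : ℕ × ℝ :=
  if b.1 < a.1 then a else if a.1 < b.1 then b else (a.1, a.2 + b.2)

namespace MvPolynomial

variable {σ R : Type*} [CommRing R]

lemma restrictTotalDegree_mono {m n : ℕ} (h : m ≤ n) :
    restrictTotalDegree σ R m ≤ restrictTotalDegree σ R n := fun p hp => by
  rw [mem_restrictTotalDegree] at hp ⊢
  exact hp.trans h

lemma one_mem_restrictTotalDegree (n : ℕ) :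
    (1 : MvPolynomial σ R) ∈ restrictTotalDegree σ R n := by
  rw [mem_restrictTotalDegree]
  simp

lemma mul_mem_restrictTotalDegree {m n : ℕ} {p q : MvPolynomial σ R}
    (hp : p ∈ restrictTotalDegree σ R m) (hq : q ∈ restrictTotalDegree σ R n) :
    p * q ∈ restrictTotalDegree σ R (m + n) := by
  rw [mem_restrictTotalDegree] at hp hq ⊢
  exact (totalDegree_mul p q).trans (add_le_add hp hq)

variable (σ R) in
/-- The Rees algebra of the filtration by total degree: generated over `R` by `t` and the `xᵢ t`
inside `R[x][t]`. -/
noncomputable def degreeRees : Subalgebra R (Polynomial (MvPolynomial σ R)) :=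
  Algebra.adjoin R (insert Polynomial.X (Set.range fun i => Polynomial.monomial 1 (X i)))

instance [Finite σ] [IsNoetherianRing R] : IsNoetherianRing (degreeRees σ R) := by
  refine isNoetherianRing_of_fg ⟨((Set.finite_range fun i : σ =>
    Polynomial.monomial 1 (X i : MvPolynomial σ R)).insert Polynomial.X).toFinset, ?_⟩
  rw [Set.Finite.coe_toFinset, degreeRees]

lemma coeff_mem_of_mem_degreeRees {p : Polynomial (MvPolynomial σ R)} (hp : p ∈ degreeRees σ R)
    (n : ℕ) : p.coeff n ∈ restrictTotalDegree σ R n := by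
  induction hp using Algebra.adjoin_induction generalizing n with
  | mem x hx =>
    obtain rfl | ⟨i, rfl⟩ := hx
    · rw [Polynomial.coeff_X]
      split_ifs
      exacts [one_mem_restrictTotalDegree n, zero_mem _]
    · dsimp only
      rw [Polynomial.coeff_monomial]
      split_ifs with h
      · subst h
        rw [mem_restrictTotalDegree, X]
        exact (totalDegree_monomial_le _ _).trans (by simp)
      · exact zero_mem _
  | algebraMap r =>
    rw [Polynomial.algebraMap_apply, Polynomial.coeff_C]
    split_ifs
    · rw [mem_restrictTotalDegree, algebraMap_eq, totalDegree_C]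
      exact Nat.zero_le _
    · exact zero_mem _
  | add x y _ _ hx hy =>
    rw [Polynomial.coeff_add]
    exact add_mem (hx n) (hy n)
  | mul x y _ _ hx hy =>
    rw [Polynomial.coeff_mul]
    refine sum_mem fun a ha => ?_
    rw [← Finset.HasAntidiagonal.mem_antidiagonal.mp ha]
    exact mul_mem_restrictTotalDegree (hx _) (hy _)

lemma monomial_mem_degreeRees {p : MvPolynomial σ R} {n : ℕ}
    (hp : p ∈ restrictTotalDegree σ R n) : Polynomial.monomial n p ∈ degreeRees σ R := by
  have hX : Polynomial.X ∈ degreeRees σ R := Algebra.subset_adjoin (Set.mem_insert _ _)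
  have hmon (a : σ →₀ ℕ) :
      Polynomial.monomial a.degree (monomial a (1 : R)) ∈ degreeRees σ R := by
    induction a using Finsupp.induction_linear with
    | zero => simp
    | add a b ha hb =>
      have := mul_mem ha hb
      rwa [Polynomial.monomial_mul_monomial, monomial_mul, mul_one, ← map_add] at this
    | single i m =>
      rw [Finsupp.degree_single]
      have := pow_mem (Algebra.subset_adjoin (Set.mem_insert_of_mem _ ⟨i, rfl⟩) :
        Polynomial.monomial 1 (X i) ∈ degreeRees σ R) m
      rwa [Polynomial.monomial_pow, one_mul, X_pow_eq_monomial] at this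
  rw [p.as_sum, map_sum]
  refine sum_mem fun a ha => ?_
  rw [mem_restrictTotalDegree] at hp
  have had : a.degree ≤ n := (le_totalDegree ha).trans hp
  have h := Subalgebra.smul_mem _ (mul_mem (hmon a) (pow_mem hX (n - a.degree))) (p.coeff a)
  rwa [Polynomial.monomial_mul_X_pow, Nat.add_sub_cancel' had, Polynomial.smul_monomial,
    smul_monomial, smul_eq_mul, mul_one] at h

variable {M : Type*} [AddCommGroup M] [Module R M] [Module (MvPolynomial σ R) M]
  [IsScalarTower R (MvPolynomial σ R) M]

lemma le_restrictTotalDegree_smul (n : ℕ) (V : Submodule R M) :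
    V ≤ restrictTotalDegree σ R n • V := fun v hv => by
  simpa using Submodule.smul_mem_smul (one_mem_restrictTotalDegree (σ := σ) (R := R) n) hv

lemma restrictTotalDegree_smul_smul_le (m n : ℕ) (V : Submodule R M) :
    restrictTotalDegree σ R m • restrictTotalDegree σ R n • V ≤
      restrictTotalDegree σ R (m + n) • V := by
  rw [← Submodule.smul_assoc]
  exact Submodule.smul_mono_left
    (Submodule.smul_le.mpr fun p hp q hq => mul_mem_restrictTotalDegree hp hq)

/-- Artin–Rees lemma for the filtration by total degree. -/
theorem exists_inf_restrictTotalDegree_smul_le [Finite σ] [IsNoetherianRing R]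
    (N : Submodule (MvPolynomial σ R) M) {V : Submodule R M} (hV : V.FG) :
    ∃ c, ∀ n, N.restrictScalars R ⊓ restrictTotalDegree σ R n • V ≤
      restrictTotalDegree σ R n • (N.restrictScalars R ⊓ restrictTotalDegree σ R c • V) := by
  let E := PolynomialModule (MvPolynomial σ R) M
  let F : Submodule (degreeRees σ R) E :=
    Submodule.span _ (PolynomialModule.single (MvPolynomial σ R) 0 '' (V : Set M))
  let G : Set E := {x | ∃ n, ∃ m ∈ N.restrictScalars R ⊓ restrictTotalDegree σ R n • V,
    PolynomialModule.single (MvPolynomial σ R) n m = x}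
  have hF : F.FG := by
    classical
    obtain ⟨s, rfl⟩ := hV
    refine ⟨s.image (PolynomialModule.single (MvPolynomial σ R) 0), le_antisymm ?_ ?_⟩
    · rw [Finset.coe_image]
      exact Submodule.span_mono (Set.image_mono Submodule.subset_span)
    · rw [Submodule.span_le]
      rintro _ ⟨v, hv, rfl⟩
      rw [SetLike.mem_coe, Finset.coe_image]
      induction hv using Submodule.span_induction with
      | mem v hv => exact Submodule.subset_span ⟨v, hv, rfl⟩
      | zero =>
        rw [PolynomialModule.single_zero]
        exact zero_mem _
      | add v w _ _ hv hw =>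
        rw [PolynomialModule.single_add]
        exact add_mem hv hw
      | smul r v _ hv =>
        have hr : C r ∈ restrictTotalDegree σ R 0 := by
          rw [mem_restrictTotalDegree, totalDegree_C]
        have := Submodule.smul_mem _ ⟨_, monomial_mem_degreeRees hr⟩ hv
        rwa [Subalgebra.smul_def, PolynomialModule.monomial_smul_single, add_zero,
          ← algebraMap_eq, algebraMap_smul] at this
  have hGF : Submodule.span (degreeRees σ R) G ≤ F := by
    rw [Submodule.span_le]
    rintro _ ⟨n, m, ⟨-, hm⟩, rfl⟩
    refine Submodule.smul_induction_on hm (fun p hp v hv => ?_) (fun x y hx hy => ?_)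
    · have := F.smul_mem ⟨_, monomial_mem_degreeRees hp⟩ (Submodule.subset_span ⟨v, hv, rfl⟩)
      rwa [Subalgebra.smul_def, PolynomialModule.monomial_smul_single, add_zero] at this
    · rw [PolynomialModule.single_add]
      exact F.add_mem hx hy
  obtain ⟨s, hsG, hs⟩ := (Submodule.fg_span_iff_fg_span_finset_subset G).mp (Submodule.FG.of_le (R := degreeRees σ R) hF hGF)
  choose! d m hm hd using fun x (hx : x ∈ s) => hsG hx
  refine ⟨s.sup d, fun n x hx => ?_⟩
  set W := N.restrictScalars R ⊓ restrictTotalDegree σ R (s.sup d) • V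
  have key : ∀ y ∈ Submodule.span (degreeRees σ R) (s : Set E), ∀ n,
      y.coeff n ∈ restrictTotalDegree σ R n • W := by
    intro y hy
    induction hy using Submodule.span_induction with
    | mem y hy =>
      intro n
      have hyW : m y ∈ W :=
        ⟨(hm y hy).1, Submodule.smul_mono_left
          (restrictTotalDegree_mono (Finset.le_sup hy)) (hm y hy).2⟩
      rw [← hd y hy, PolynomialModule.coeff_single, Finsupp.single_apply]
      split_ifs
      exacts [le_restrictTotalDegree_smul n W hyW, zero_mem _]
    | zero => exact fun n => zero_mem _
    | add y z _ _ hy hz => exact fun n => add_mem (hy n) (hz n)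
    | smul a y _ hy =>
      intro n
      rw [Subalgebra.smul_def, PolynomialModule.smul_apply]
      refine sum_mem fun b hb => ?_
      rw [← Finset.HasAntidiagonal.mem_antidiagonal.mp hb]
      exact restrictTotalDegree_smul_smul_le _ _ _
        (Submodule.smul_mem_smul (coeff_mem_of_mem_degreeRees a.2 _) (hy _))
  have hxG : PolynomialModule.single (MvPolynomial σ R) n x ∈
      Submodule.span (degreeRees σ R) (s : Set E) :=
    hs ▸ Submodule.subset_span ⟨n, x, hx, rfl⟩
  simpa using key _ hxG n

lemma exists_le_restrictTotalDegree_smul {V W : Submodule R M} (hW : W.FG)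
    (hV : Submodule.span (MvPolynomial σ R) (V : Set M) = ⊤) :
    ∃ c, W ≤ restrictTotalDegree σ R c • V := by
  induction W, hW using Submodule.fg_induction with
  | singleton x =>
    simp_rw [Submodule.span_singleton_le_iff_mem]
    have hx : x ∈ Submodule.span (MvPolynomial σ R) (V : Set M) := hV ▸ Submodule.mem_top
    induction hx using Submodule.span_induction with
    | mem x hx => exact ⟨0, le_restrictTotalDegree_smul 0 V hx⟩
    | zero => exact ⟨0, zero_mem _⟩
    | add x y _ _ hx hy =>
      obtain ⟨a, ha⟩ := hx
      obtain ⟨b, hb⟩ := hy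
      exact ⟨max a b, add_mem
        (Submodule.smul_mono_left (restrictTotalDegree_mono (le_max_left a b)) ha)
        (Submodule.smul_mono_left (restrictTotalDegree_mono (le_max_right a b)) hb)⟩
    | smul p x _ hx =>
      obtain ⟨a, ha⟩ := hx
      exact ⟨p.totalDegree + a, restrictTotalDegree_smul_smul_le _ _ _
        (Submodule.smul_mem_smul ((mem_restrictTotalDegree _ _ _).mpr le_rfl) ha)⟩
  | sup W₁ W₂ _ _ h₁ h₂ =>
    obtain ⟨a, ha⟩ := h₁
    obtain ⟨b, hb⟩ := h₂
    exact ⟨max a b, sup_le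
      (ha.trans (Submodule.smul_mono_left (restrictTotalDegree_mono (le_max_left a b))))
      (hb.trans (Submodule.smul_mono_left (restrictTotalDegree_mono (le_max_right a b))))⟩

lemma restrictTotalDegree_smul_le_of_le {V W : Submodule R M} {c : ℕ}
    (h : W ≤ restrictTotalDegree σ R c • V) (n : ℕ) :
    restrictTotalDegree σ R n • W ≤ restrictTotalDegree σ R (n + c) • V :=
  (Submodule.smul_mono le_rfl h).trans (restrictTotalDegree_smul_smul_le n c V)

lemma fg_restrictTotalDegree_smul [Finite σ] (n : ℕ) {V : Submodule R M} (hV : V.FG) :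
    (restrictTotalDegree σ R n • V).FG := by
  have h : (restrictTotalDegree σ R n).FG := Module.Finite.iff_fg.mp inferInstance
  convert h.map₂ (Algebra.lsmul R R M).toLinearMap hV
  apply le_antisymm
  · exact Submodule.smul_le.mpr fun p hp v hv => Submodule.apply_mem_map₂ _ hp hv
  · exact Submodule.map₂_le.mpr fun p hp v hv => Submodule.smul_mem_smul hp hv

lemma map_restrictTotalDegree_smul {P : Type*} [AddCommGroup P] [Module R P]
    [Module (MvPolynomial σ R) P] [IsScalarTower R (MvPolynomial σ R) P]
    (f : M →ₗ[MvPolynomial σ R] P) (n : ℕ) (V : Submodule R M) :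
    (restrictTotalDegree σ R n • V).map (f.restrictScalars R) =
      restrictTotalDegree σ R n • V.map (f.restrictScalars R) := by
  apply le_antisymm
  · rw [Submodule.map_le_iff_le_comap, Submodule.smul_le]
    intro p hp v hv
    rw [Submodule.mem_comap, LinearMap.restrictScalars_apply, map_smul]
    exact Submodule.smul_mem_smul hp ⟨v, hv, rfl⟩
  · rw [Submodule.smul_le]
    rintro p hp _ ⟨v, hv, rfl⟩
    exact ⟨p • v, Submodule.smul_mem_smul hp hv, map_smul f p v⟩

end MvPolynomial

lemma degSmul_eq {R : Type} [CommRing R] {k : ℕ} {M : Type} [AddCommGroup M] [Module R M]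
    [Module (MvPolynomial (Fin k) R) M] [IsScalarTower R (MvPolynomial (Fin k) R) M]
    (n : ℕ) (V : Submodule R M) :
    degSmul k n V = MvPolynomial.restrictTotalDegree (Fin k) R n • V := by
  apply le_antisymm
  · rw [degSmul, Submodule.span_le]
    rintro _ ⟨p, hp, v, hv, rfl⟩
    exact Submodule.smul_mem_smul hp hv
  · exact Submodule.smul_le.mpr fun p hp v hv => Submodule.subset_span ⟨p, hp, v, hv, rfl⟩

namespace LengthFunction

variable {R : Type} [CommRing R] (L : LengthFunction R) {M N : Type} [AddCommGroup M] [Module R M]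
  [AddCommGroup N] [Module R N]

lemma l_eq_inf_ker_add_map (g : M →ₗ[R] N) (V : Submodule R M) :
    L.l V = L.l ↥(LinearMap.ker g ⊓ V) + L.l (V.map g) := by
  rw [L.l_add V (LinearMap.ker (g.domRestrict V)),
    L.l_congr _ _ (g.domRestrict V).quotKerEquivRange, LinearMap.range_domRestrict,
    LinearMap.ker_domRestrict]
  congr 1
  exact L.l_congr _ _ ((Submodule.equivMapOfInjective V.subtype V.injective_subtype _).trans
    (LinearEquiv.ofEq _ _ (by rw [Submodule.map_comap_subtype, inf_comm])))

lemma l_mono_s12 {V W : Submodule R M} (h : V ≤ W) : L.l V ≤ L.l W := by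
  rw [L.l_eq_inf_ker_add_map V.mkQ W, Submodule.ker_mkQ, inf_eq_left.mpr h]
  exact le_self_add

lemma l_map_le_s12 (g : M →ₗ[R] N) (V : Submodule R M) : L.l (V.map g) ≤ L.l V := by
  rw [L.l_eq_inf_ker_add_map g V]
  exact le_add_self

lemma l_map_of_injective {f : M →ₗ[R] N} (hf : Function.Injective f) (V : Submodule R M) :
    L.l (V.map f) = L.l V :=
  (L.l_congr _ _ (Submodule.equivMapOfInjective f hf V)).symm

end LengthFunction

namespace Polynomial

open Filter

lemma leadingCoeff_nonneg_of_eventually_nonneg {p : ℝ[X]}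
    (h : ∀ᶠ n : ℕ in atTop, 0 ≤ p.eval (n : ℝ)) : 0 ≤ p.leadingCoeff := by
  by_contra! hlt
  obtain hd | hd := p.natDegree.eq_zero_or_pos
  · obtain ⟨n, hn⟩ := h.exists
    rw [eq_C_of_natDegree_eq_zero hd] at hn hlt
    rw [eval_C] at hn
    rw [leadingCoeff_C] at hlt
    exact hn.not_gt hlt
  · have ht := (p.tendsto_atBot_of_leadingCoeff_nonpos (natDegree_pos_iff_degree_pos.mp hd)
      hlt.le).comp tendsto_natCast_atTop_atTop
    obtain ⟨n, hn, hn'⟩ := (h.and (ht.eventually_lt_atBot 0)).exists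
    exact hn.not_gt hn'

lemma natDegree_le_of_eventually_le {p q : ℝ[X]} (hp : 0 ≤ p.leadingCoeff)
    (h : ∀ᶠ n : ℕ in atTop, p.eval (n : ℝ) ≤ q.eval (n : ℝ)) : p.natDegree ≤ q.natDegree := by
  by_contra! hlt
  have h₀ : 0 ≤ (q - p).leadingCoeff :=
    leadingCoeff_nonneg_of_eventually_nonneg (by simpa using h)
  rw [sub_eq_add_neg, leadingCoeff_add_of_degree_lt (by simpa using degree_lt_degree hlt),
    leadingCoeff_neg] at h₀
  have : p = 0 := leadingCoeff_eq_zero.mp (by linarith)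
  simp [this] at hlt

lemma leadingCoeff_le_of_eventually_le {p q : ℝ[X]} (hd : p.natDegree = q.natDegree)
    (h : ∀ᶠ n : ℕ in atTop, p.eval (n : ℝ) ≤ q.eval (n : ℝ)) :
    p.leadingCoeff ≤ q.leadingCoeff := by
  by_contra! hlt
  have h₀ : 0 ≤ (q - p).leadingCoeff :=
    leadingCoeff_nonneg_of_eventually_nonneg (by simpa using h)
  have hc : (q - p).coeff q.natDegree = q.leadingCoeff - p.leadingCoeff := by
    rw [coeff_sub, leadingCoeff, leadingCoeff, hd]
  have hn : (q - p).natDegree = q.natDegree :=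
    natDegree_eq_of_le_of_coeff_ne_zero
      ((natDegree_sub_le q p).trans (by rw [hd, max_self])) (by rw [hc]; linarith)
  rw [leadingCoeff, hn, hc] at h₀
  linarith

lemma leadingMonomial_add {p q : ℝ[X]} (hp : 0 ≤ p.leadingCoeff) (hq : 0 ≤ q.leadingCoeff) :
    ((p + q).natDegree, (p + q).leadingCoeff) =
      mOplus (p.natDegree, p.leadingCoeff) (q.natDegree, q.leadingCoeff) := by
  obtain h | h | h := lt_trichotomy p.natDegree q.natDegree
  · simp [mOplus, h, h.not_gt, natDegree_add_eq_right_of_natDegree_lt h,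
      leadingCoeff_add_of_degree_lt (degree_lt_degree h)]
  · have hc : (p + q).coeff p.natDegree = p.leadingCoeff + q.leadingCoeff := by
      rw [coeff_add, leadingCoeff, leadingCoeff, h]
    have hn : (p + q).natDegree = p.natDegree := by
      obtain h₀ | h₀ := hp.eq_or_lt
      · have hp₀ : p = 0 := leadingCoeff_eq_zero.mp h₀.symm
        rw [h, hp₀, zero_add]
      · exact natDegree_eq_of_le_of_coeff_ne_zero
          ((natDegree_add_le p q).trans (by rw [h, max_self])) (by rw [hc]; linarith)
    rw [leadingCoeff, hn, hc]
    simp [mOplus, h]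
  · simp [mOplus, h, natDegree_add_eq_left_of_natDegree_lt h,
      leadingCoeff_add_of_degree_lt' (degree_lt_degree h)]

/-- A polynomial squeezed between two shifts of `p` has the leading monomial of `p`. -/
lemma leadingMonomial_eq_of_eventually_le_shift {p q : ℝ[X]} (d : ℕ) (hp : 0 ≤ p.leadingCoeff)
    (hpq : ∀ᶠ n : ℕ in atTop, p.eval (n : ℝ) ≤ q.eval ((n + d : ℕ) : ℝ))
    (hqp : ∀ᶠ n : ℕ in atTop, q.eval (n : ℝ) ≤ p.eval ((n + d : ℕ) : ℝ))
    (hq : 0 ≤ q.leadingCoeff) :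
    (q.natDegree, q.leadingCoeff) = (p.natDegree, p.leadingCoeff) := by
  replace hpq : ∀ᶠ n : ℕ in atTop, p.eval (n : ℝ) ≤ (taylor (d : ℝ) q).eval (n : ℝ) := by
    simpa [taylor_eval] using hpq
  replace hqp : ∀ᶠ n : ℕ in atTop, q.eval (n : ℝ) ≤ (taylor (d : ℝ) p).eval (n : ℝ) := by
    simpa [taylor_eval] using hqp
  have h₁ := natDegree_le_of_eventually_le hp hpq
  have h₂ := natDegree_le_of_eventually_le hq hqp
  rw [natDegree_taylor] at h₁ h₂
  have hd := h₂.antisymm h₁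
  have h₃ := leadingCoeff_le_of_eventually_le (by rw [natDegree_taylor, hd]) hpq
  have h₄ := leadingCoeff_le_of_eventually_le (by rw [natDegree_taylor, hd]) hqp
  rw [leadingCoeff_taylor] at h₃ h₄
  rw [hd, h₄.antisymm h₃]

end Polynomial

open Filter in
/-- Additivity: Let `R` be a Noetherian commutative ring, `λ` a length function on
`R`-modules, `S = R[x₁,…,x_k]`, and `0 → A → B → C → 0` an exact sequence of `S`-modules with `B`
λ_S-small (finitely generated over `S` and locally λ_R-finite).  Then `μ(B) = μ(A) ⊕ μ(C)`:
for any choices of finitely generated generating `R`-submodules of finite length and of the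
corresponding Hilbert polynomials `q_A, q_B, q_C`, the leading monomial of `q_B` equals the ⊕-sum
of the leading monomials of `q_A` and `q_C`. -/
theorem stmt_12 {R : Type} [CommRing R] [IsNoetherianRing R] {k : ℕ} (L : LengthFunction R)
    {A B C : Type} [AddCommGroup A] [Module R A]
    [Module (MvPolynomial (Fin k) R) A] [IsScalarTower R (MvPolynomial (Fin k) R) A]
    [AddCommGroup B] [Module R B]
    [Module (MvPolynomial (Fin k) R) B] [IsScalarTower R (MvPolynomial (Fin k) R) B]
    [AddCommGroup C] [Module R C]
    [Module (MvPolynomial (Fin k) R) C] [IsScalarTower R (MvPolynomial (Fin k) R) C]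
    (f : A →ₗ[MvPolynomial (Fin k) R] B) (g : B →ₗ[MvPolynomial (Fin k) R] C)
    (hf : Function.Injective f) (hg : Function.Surjective g)
    (hfg : LinearMap.range f = LinearMap.ker g)
    (hBfg : Module.Finite (MvPolynomial (Fin k) R) B)
    (hBloc : ∀ V : Submodule R B, V.FG → L.l V < ⊤) :
    ∀ (VA : Submodule R A) (VB : Submodule R B) (VC : Submodule R C),
      VA.FG → VB.FG → VC.FG →
      L.l VA < ⊤ → L.l VB < ⊤ → L.l VC < ⊤ →
      Submodule.span (MvPolynomial (Fin k) R) (VA : Set A) = ⊤ →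
      Submodule.span (MvPolynomial (Fin k) R) (VB : Set B) = ⊤ →
      Submodule.span (MvPolynomial (Fin k) R) (VC : Set C) = ⊤ →
      ∀ qA qB qC : Polynomial ℝ,
        (∀ᶠ n : ℕ in atTop, (L.l (degSmul k n VA)).toReal = qA.eval (n : ℝ)) →
        (∀ᶠ n : ℕ in atTop, (L.l (degSmul k n VB)).toReal = qB.eval (n : ℝ)) →
        (∀ᶠ n : ℕ in atTop, (L.l (degSmul k n VC)).toReal = qC.eval (n : ℝ)) →
        (qB.natDegree, qB.leadingCoeff) =
          mOplus (qA.natDegree, qA.leadingCoeff) (qC.natDegree, qC.leadingCoeff) := by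
  intro VA VB VC hVA hVB hVC _ _ _ hA hB hC qA qB qC hqA hqB hqC
  let S := MvPolynomial.restrictTotalDegree (Fin k) R
  have hdeg {M : Type} [AddCommGroup M] [Module R M] [Module (MvPolynomial (Fin k) R) M]
      [IsScalarTower R (MvPolynomial (Fin k) R) M] (n : ℕ) (V : Submodule R M) :
      L.l ↥(degSmul k n V) = L.l ↥(S n • V) := by rw [degSmul_eq]
  simp only [hdeg] at hqA hqB hqC
  have hf' : Function.Injective (f.restrictScalars R) := hf
  have finA (V : Submodule R A) (hV : V.FG) : L.l V ≠ ⊤ := by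
    rw [← L.l_map_of_injective hf']
    exact (hBloc _ (hV.map _)).ne
  have finC (V : Submodule R C) (hV : V.FG) : L.l V ≠ ⊤ := by
    classical
    obtain ⟨s, rfl⟩ := hV
    have h : (Submodule.span R (s.image (Function.surjInv hg) : Set B)).map
        (g.restrictScalars R) = Submodule.span R (s : Set C) := by
      rw [Submodule.map_span, Finset.coe_image, Set.image_image]
      simp [Function.surjInv_eq hg]
    rw [← h]
    exact ((L.l_map_le_s12 _ _).trans_lt (hBloc _ ⟨_, rfl⟩)).ne
  have hsplit (n : ℕ) : L.l ↥(S n • VB) =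
      L.l ↥((LinearMap.ker g).restrictScalars R ⊓ S n • VB) +
        L.l ↥(S n • VB.map (g.restrictScalars R)) := by
    rw [L.l_eq_inf_ker_add_map (g.restrictScalars R), MvPolynomial.map_restrictTotalDegree_smul]
    rfl
  have hker : (LinearMap.ker g).restrictScalars R = LinearMap.range (f.restrictScalars R) := by
    rw [← hfg]
    rfl
  have hgB : Submodule.span (MvPolynomial (Fin k) R)
      (VB.map (g.restrictScalars R) : Set C) = ⊤ := by
    rw [Submodule.map_coe, LinearMap.coe_restrictScalars, ← Submodule.map_span, hB,
      Submodule.map_top, LinearMap.range_eq_top.mpr hg]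
  obtain ⟨c, hc⟩ := MvPolynomial.exists_inf_restrictTotalDegree_smul_le (LinearMap.ker g) hVB
  have hSB (n : ℕ) : (S n • VB).FG := MvPolynomial.fg_restrictTotalDegree_smul n hVB
  have hWfg : (Submodule.comap (f.restrictScalars R) (S c • VB)).FG := by
    refine Submodule.fg_of_fg_map_injective _ hf' ?_
    rw [Submodule.map_comap_eq]
    exact (hSB c).of_le inf_le_right
  obtain ⟨a, ha⟩ := MvPolynomial.exists_le_restrictTotalDegree_smul hWfg hA
  obtain ⟨b, hb⟩ := MvPolynomial.exists_le_restrictTotalDegree_smul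
    (hVA.map (f.restrictScalars R)) hB
  obtain ⟨u, hu⟩ := MvPolynomial.exists_le_restrictTotalDegree_smul
    (hVB.map (g.restrictScalars R)) hC
  obtain ⟨v, hv⟩ := MvPolynomial.exists_le_restrictTotalDegree_smul hVC hgB
  have monoS {M : Type} [AddCommGroup M] [Module R M] [Module (MvPolynomial (Fin k) R) M]
      [IsScalarTower R (MvPolynomial (Fin k) R) M] (V : Submodule R M) {m n : ℕ} (h : m ≤ n) :
      S m • V ≤ S n • V :=
    Submodule.smul_mono_left (MvPolynomial.restrictTotalDegree_mono h)
  have hupper (n d : ℕ) (had : a ≤ d) (hud : u ≤ d) :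
      L.l ↥(S n • VB) ≤ L.l ↥(S (n + d) • VA) + L.l ↥(S (n + d) • VC) := by
    rw [hsplit]
    refine add_le_add ?_ (L.l_mono_s12 ?_)
    · rw [← L.l_map_of_injective hf' (S (n + d) • VA)]
      refine L.l_mono_s12 ((hc n).trans ?_)
      rw [hker, ← Submodule.map_comap_eq, ← MvPolynomial.map_restrictTotalDegree_smul]
      exact Submodule.map_mono ((MvPolynomial.restrictTotalDegree_smul_le_of_le ha n).trans
        (monoS _ (by lia)))
    · exact (MvPolynomial.restrictTotalDegree_smul_le_of_le hu n).trans (monoS _ (by lia))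
  have hlower (n d : ℕ) (hbd : b ≤ d) (hvd : v ≤ d) :
      L.l ↥(S n • VA) + L.l ↥(S n • VC) ≤ L.l ↥(S (n + d) • VB) := by
    rw [hsplit]
    refine add_le_add ?_ (L.l_mono_s12 ?_)
    · rw [← L.l_map_of_injective hf' (S n • VA)]
      refine L.l_mono_s12 (le_inf ?_ ?_)
      · rw [hker]
        exact LinearMap.map_le_range
      · rw [MvPolynomial.map_restrictTotalDegree_smul]
        exact (MvPolynomial.restrictTotalDegree_smul_le_of_le hb n).trans (monoS _ (by lia))
    · exact (MvPolynomial.restrictTotalDegree_smul_le_of_le hv n).trans (monoS _ (by lia))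
  have hAn (n : ℕ) : L.l ↥(S n • VA) ≠ ⊤ :=
    finA _ (MvPolynomial.fg_restrictTotalDegree_smul n hVA)
  have hCn (n : ℕ) : L.l ↥(S n • VC) ≠ ⊤ :=
    finC _ (MvPolynomial.fg_restrictTotalDegree_smul n hVC)
  have hlA := Polynomial.leadingCoeff_nonneg_of_eventually_nonneg
    (hqA.mono fun n hn => hn ▸ ENNReal.toReal_nonneg)
  have hlB := Polynomial.leadingCoeff_nonneg_of_eventually_nonneg
    (hqB.mono fun n hn => hn ▸ ENNReal.toReal_nonneg)
  have hlC := Polynomial.leadingCoeff_nonneg_of_eventually_nonneg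
    (hqC.mono fun n hn => hn ▸ ENNReal.toReal_nonneg)
  have hlAC : 0 ≤ (qA + qC).leadingCoeff := by
    refine Polynomial.leadingCoeff_nonneg_of_eventually_nonneg ?_
    filter_upwards [hqA, hqC] with n h₁ h₂
    rw [Polynomial.eval_add, ← h₁, ← h₂]
    positivity
  obtain ⟨d, had, hbd, hud, hvd⟩ : ∃ d, a ≤ d ∧ b ≤ d ∧ u ≤ d ∧ v ≤ d :=
    ⟨a + b + u + v, by lia, by lia, by lia, by lia⟩
  have hshift := tendsto_add_atTop_nat d
  rw [← Polynomial.leadingMonomial_add hlA hlC]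
  refine Polynomial.leadingMonomial_eq_of_eventually_le_shift d hlAC ?_ ?_ hlB
  · filter_upwards [hqA, hqC, hshift.eventually hqB] with n h₁ h₂ h₃
    rw [Polynomial.eval_add, ← h₁, ← h₂, ← h₃, ← ENNReal.toReal_add (hAn n) (hCn n)]
    exact ENNReal.toReal_mono (hBloc _ (hSB _)).ne (hlower n d hbd hvd)
  · filter_upwards [hshift.eventually hqA, hshift.eventually hqC, hqB] with n h₁ h₂ h₃
    rw [Polynomial.eval_add, ← h₁, ← h₂, ← h₃, ← ENNReal.toReal_add (hAn _) (hCn _)]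
    exact ENNReal.toReal_mono (ENNReal.add_ne_top.mpr ⟨hAn _, hCn _⟩) (hupper n d had hud)
end

section
/- Let R be a field, let λ be the length function on R-modules given by λ(M) = dim_R(M) (the linear dimension as an R-vector space), and let T be a finitely generated commutative R-algebra. Then the λ-dimension of T (as a T-module) equals the Krull dimension of T. -/
open scoped ENNReal

open Filter in
theorem Polynomial.natDegree_le_of_eventually_eval_natCast_le {p q : Polynomial ℝ}
    (h0 : ∀ᶠ n : ℕ in atTop, 0 ≤ p.eval (n : ℝ))
    (h : ∀ᶠ n : ℕ in atTop, p.eval (n : ℝ) ≤ q.eval (n : ℝ)) :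
    p.natDegree ≤ q.natDegree := by
  by_contra! hlt
  have hp : p ≠ 0 := by
    rintro rfl
    simp at hlt
  have hdeg : q.degree < p.degree := Polynomial.degree_lt_degree hlt
  have hlim := (Polynomial.div_tendsto_atTop_zero_of_degree_lt q p hdeg).comp
    (tendsto_natCast_atTop_atTop (R := ℝ))
  have hsmall := hlim.eventually (gt_mem_nhds (zero_lt_one' ℝ))
  have hne : ∀ᶠ n : ℕ in atTop, ¬ p.IsRoot (n : ℝ) :=
    (tendsto_natCast_atTop_atTop (R := ℝ)).eventually (Polynomial.eventually_atTop_not_isRoot p hp)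
  obtain ⟨n, h0, h, hsmall, hne⟩ := (h0.and (h.and (hsmall.and hne))).exists
  have hpos : 0 < p.eval (n : ℝ) := lt_of_le_of_ne h0 (Ne.symm hne)
  have := (div_lt_one hpos).1 hsmall
  linarith

/-- An injective integral extension preserves the Krull dimension. -/
theorem ringKrullDim_eq_of_isIntegral_of_injective {A B : Type*} [CommRing A] [CommRing B]
    [Algebra A B] [Algebra.IsIntegral A B] (hinj : Function.Injective (algebraMap A B)) :
    ringKrullDim B = ringKrullDim A := by
  apply le_antisymm
  · exact Order.krullDim_le_of_strictMono (PrimeSpectrum.comap (algebraMap A B))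
      fun I J hIJ ↦ Ideal.IsIntegral.comap_lt_comap (I := I.asIdeal) (J := J.asIdeal) hIJ
  · refine iSup_le fun l ↦ ?_
    obtain ⟨P, -, hP, hPl⟩ := Ideal.exists_ideal_over_prime_of_isIntegral
      l.head.asIdeal (⊥ : Ideal B) (by
        rw [← RingHom.ker_eq_comap_bot, (RingHom.injective_iff_ker_eq_bot _).1 hinj]
        exact bot_le)
    have : P.LiesOver l.head.asIdeal := ⟨hPl.symm⟩
    obtain ⟨l', hl', -⟩ := Ideal.exists_ltSeries_of_hasGoingUp l P
    rw [← hl']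
    exact Order.LTSeries.length_le_krullDim l'

theorem Submodule.finrank_mul_le {K A : Type*} [Field K] [CommRing A] [Algebra K A]
    (P Q : Submodule K A) [FiniteDimensional K P] [FiniteDimensional K Q] :
    Module.finrank K ↥(P * Q) ≤ Module.finrank K P * Module.finrank K Q := by
  rw [← Submodule.mulMap_range, ← Module.finrank_tensorProduct]
  exact LinearMap.finrank_range_le _

namespace MvPolynomial

theorem restrictTotalDegree_zero (σ R : Type*) [CommSemiring R] :
    restrictTotalDegree σ R 0 = 1 := by
  rw [restrictTotalDegree, ← restrictSupport_zero]
  congr 1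
  ext a
  simp only [Set.mem_ofPred_eq, nonpos_iff_eq_zero, Set.mem_zero]
  exact Finsupp.degree_eq_zero_iff a

open scoped Pointwise in
theorem restrictTotalDegree_succ (σ R : Type*) [CommSemiring R] (n : ℕ) :
    restrictTotalDegree σ R (n + 1) = restrictTotalDegree σ R n * restrictTotalDegree σ R 1 := by
  simp only [restrictTotalDegree]
  rw [← restrictSupport_add]
  congr 1
  ext a
  change a.degree ≤ n + 1 ↔ a ∈ {a : σ →₀ ℕ | a.degree ≤ n} + {a : σ →₀ ℕ | a.degree ≤ 1}
  simp only [Set.mem_add, Set.mem_ofPred_eq]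
  constructor
  · intro ha
    by_cases h0 : a = 0
    · exact ⟨0, by simp, 0, by simp, by simp [h0]⟩
    · obtain ⟨i, hi⟩ := Finsupp.ne_iff.1 h0
      have hle : Finsupp.single i 1 ≤ a := by
        rw [Finsupp.single_le_iff]
        exact Nat.one_le_iff_ne_zero.2 hi
      have heq := tsub_add_cancel_of_le hle
      have hdeg := congrArg Finsupp.degree heq
      rw [map_add, Finsupp.degree_single] at hdeg
      exact ⟨a - Finsupp.single i 1, by lia, Finsupp.single i 1, by simp, heq⟩
  · rintro ⟨b, hb, c, hc, rfl⟩
    rw [map_add]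
    lia

theorem restrictTotalDegree_eq_pow (σ R : Type*) [CommSemiring R] (n : ℕ) :
    restrictTotalDegree σ R n = restrictTotalDegree σ R 1 ^ n := by
  induction n with
  | zero => rw [restrictTotalDegree_zero, pow_zero]
  | succ n ih => rw [restrictTotalDegree_succ, ih, pow_succ]

theorem finrank_restrictDegree (K : Type*) [Field K] (s m : ℕ) :
    Module.finrank K (restrictDegree (Fin s) K m) = (m + 1) ^ s := by
  let e : (Fin s → Fin (m + 1)) ≃ {a : Fin s →₀ ℕ | ∀ i, a i ≤ m} :=
    { toFun f := ⟨Finsupp.equivFunOnFinite.symm fun i ↦ f i, fun i ↦ Nat.lt_succ_iff.1 (f i).2⟩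
      invFun a i := ⟨a.1 i, Nat.lt_succ_iff.2 (a.2 i)⟩
      left_inv f := by ext; simp
      right_inv a := by ext; simp }
  rw [restrictDegree, Module.finrank_eq_nat_card_basis (basisRestrictSupport K _),
    ← Nat.card_congr e]
  simp

theorem restrictDegree_le_restrictTotalDegree (R : Type*) [CommSemiring R] (s m : ℕ) :
    restrictDegree (Fin s) R m ≤ restrictTotalDegree (Fin s) R (s * m) := by
  apply restrictSupport_mono
  intro a ha
  change a.degree ≤ s * m
  rw [Finsupp.degree_eq_sum]
  calc ∑ i, a i ≤ ∑ _i : Fin s, m := Finset.sum_le_sum fun i _ ↦ ha i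
    _ = s * m := by simp

theorem finrank_restrictTotalDegree_le (K : Type*) [Field K] (s m : ℕ) :
    Module.finrank K (restrictTotalDegree (Fin s) K m) ≤ (m + 1) ^ s := by
  rw [← finrank_restrictDegree K]
  exact Submodule.finrank_mono (restrictTotalDegree_le_restrictDegree _ _ _)

theorem le_finrank_restrictTotalDegree (K : Type*) [Field K] (s m : ℕ) :
    (m + 1) ^ s ≤ Module.finrank K (restrictTotalDegree (Fin s) K (s * m)) := by
  rw [← finrank_restrictDegree K]
  exact Submodule.finrank_mono (restrictDegree_le_restrictTotalDegree _ _ _)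

/-- The image in an algebra of the polynomials of total degree at most `n`. -/
noncomputable def degreeImage {K A : Type*} {k : ℕ} [Field K] [CommRing A] [Algebra K A]
    (ψ : MvPolynomial (Fin k) K →ₐ[K] A) (n : ℕ) : Submodule K A :=
  (restrictTotalDegree (Fin k) K n).map ψ.toLinearMap

section degreeImage

variable {K A : Type*} {k : ℕ} [Field K] [CommRing A] [Algebra K A]
  (ψ : MvPolynomial (Fin k) K →ₐ[K] A)

instance (n : ℕ) : FiniteDimensional K (degreeImage ψ n) :=
  inferInstanceAs (FiniteDimensional K ((restrictTotalDegree (Fin k) K n).map ψ.toLinearMap))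

theorem degreeImage_fg (n : ℕ) : (degreeImage ψ n).FG :=
  Module.Finite.iff_fg.1 inferInstance

theorem degreeImage_eq_pow (n : ℕ) : degreeImage ψ n = degreeImage ψ 1 ^ n := by
  rw [degreeImage, restrictTotalDegree_eq_pow, Submodule.map_pow, degreeImage]

theorem degreeImage_add (m n : ℕ) :
    degreeImage ψ (m + n) = degreeImage ψ m * degreeImage ψ n := by
  rw [degreeImage_eq_pow ψ (m + n), degreeImage_eq_pow ψ m, degreeImage_eq_pow ψ n, pow_add]

theorem degreeImage_mul (m n : ℕ) :
    degreeImage ψ (m * n) = degreeImage ψ m ^ n := by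
  rw [degreeImage_eq_pow ψ (m * n), degreeImage_eq_pow ψ m, pow_mul]

theorem degreeImage_mono : Monotone (degreeImage ψ) := fun _ _ h ↦
  Submodule.map_mono fun _ hp ↦ (mem_restrictTotalDegree _ _ _).2
    (((mem_restrictTotalDegree _ _ _).1 hp).trans h)

theorem exists_mem_degreeImage (p : MvPolynomial (Fin k) K) : ∃ n, ψ p ∈ degreeImage ψ n :=
  ⟨p.totalDegree, Submodule.mem_map_of_mem ((mem_restrictTotalDegree _ _ _).2 le_rfl)⟩

theorem finrank_degreeImage_le (n : ℕ) :
    Module.finrank K (degreeImage ψ n) ≤ (n + 1) ^ k :=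
  (Submodule.finrank_map_le _ _).trans (finrank_restrictTotalDegree_le K k n)

theorem le_finrank_degreeImage (hψ : Function.Injective ψ) (m : ℕ) :
    (m + 1) ^ k ≤ Module.finrank K (degreeImage ψ (k * m)) := by
  rw [degreeImage, ← (Submodule.equivMapOfInjective ψ.toLinearMap hψ _).finrank_eq]
  exact le_finrank_restrictTotalDegree K k m

/-- If `W` generates `A` over the image of `ψ`, then every finitely generated subspace of `A`
lies in some term of the filtration of `A` induced by `W`. -/
theorem exists_le_degreeImage_mul {W : Submodule K A}
    (hW : LinearMap.range ψ.toLinearMap * W = ⊤) {Z : Submodule K A} (hZ : Z.FG) :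
    ∃ n, Z ≤ degreeImage ψ n * W := by
  have hmono : Monotone fun n ↦ degreeImage ψ n * W := fun _ _ h ↦
    mul_le_mul' (degreeImage_mono ψ h) le_rfl
  have hmem (t : A) : ∃ n, t ∈ degreeImage ψ n * W := by
    have ht : t ∈ LinearMap.range ψ.toLinearMap * W := hW ▸ Submodule.mem_top
    refine Submodule.mul_induction_on ht ?_ ?_
    · rintro _ ⟨p, rfl⟩ w hw
      obtain ⟨n, hn⟩ := exists_mem_degreeImage ψ p
      exact ⟨n, Submodule.mul_mem_mul hn hw⟩
    · rintro x y ⟨m, hm⟩ ⟨n, hn⟩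
      exact ⟨max m n, add_mem (hmono (le_max_left m n) hm) (hmono (le_max_right m n) hn)⟩
  choose f hf using hmem
  obtain ⟨S, rfl⟩ := hZ
  refine ⟨S.sup f, Submodule.span_le.2 fun t ht ↦ ?_⟩
  exact hmono (Finset.le_sup ht) (hf t)

variable {s : ℕ} (g : MvPolynomial (Fin s) K →ₐ[K] A)

theorem degreeImage_mul_le_of_le {W : Submodule K A} {c : ℕ}
    (hc : degreeImage ψ 1 * W ≤ degreeImage g c * W) (n : ℕ) :
    degreeImage ψ n * W ≤ degreeImage g (c * n) * W := by
  rw [degreeImage_eq_pow ψ, degreeImage_mul g]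
  induction n with
  | zero => simp
  | succ n ih =>
    calc degreeImage ψ 1 ^ (n + 1) * W = degreeImage ψ 1 * (degreeImage ψ 1 ^ n * W) := by
          rw [pow_succ']; ring
      _ ≤ degreeImage ψ 1 * (degreeImage g c ^ n * W) := mul_le_mul' le_rfl ih
      _ = degreeImage g c ^ n * (degreeImage ψ 1 * W) := by ring
      _ ≤ degreeImage g c ^ n * (degreeImage g c * W) := mul_le_mul' le_rfl hc
      _ = degreeImage g c ^ (n + 1) * W := by rw [pow_succ]; ring

/-- If `A` is finite over the image of `g`, then the Hilbert function of `A` with respect to any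
other polynomial presentation grows at most like a polynomial of degree `s`. -/
theorem exists_finrank_degreeImage_mul_le (hg : g.Finite) {M₀ : Submodule K A} (hM₀ : M₀.FG) :
    ∃ c d : ℕ, ∀ n,
      Module.finrank K ↥(degreeImage ψ n * M₀) ≤ (c * n + 1) ^ s * d := by
  have hg' : g.toRingHom.Finite := hg
  algebraize [g.toRingHom]
  obtain ⟨S, hS⟩ := Module.Finite.fg_top (R := MvPolynomial (Fin s) K) (M := A)
  set W : Submodule K A := Submodule.span K S ⊔ M₀ with hWdef
  have hWfg : W.FG := (Submodule.fg_span S.finite_toSet).sup hM₀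
  have : FiniteDimensional K W := Module.Finite.iff_fg.2 hWfg
  have hW : LinearMap.range g.toLinearMap * W = ⊤ := by
    refine eq_top_iff.2 fun t _ ↦ ?_
    have ht : t ∈ Submodule.span (MvPolynomial (Fin s) K) (S : Set A) := hS ▸ Submodule.mem_top
    obtain ⟨f, -, rfl⟩ := Submodule.mem_span_finset.1 ht
    refine sum_mem fun a ha ↦ ?_
    rw [Algebra.smul_def]
    exact Submodule.mul_mem_mul ⟨f a, rfl⟩ (Submodule.mem_sup_left (Submodule.subset_span ha))
  obtain ⟨c, hc⟩ := exists_le_degreeImage_mul g hW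
    ((degreeImage_fg ψ 1).mul hWfg)
  refine ⟨c, Module.finrank K W, fun n ↦ ?_⟩
  have hle : degreeImage ψ n * M₀ ≤ degreeImage g (c * n) * W :=
    (mul_le_mul' le_rfl le_sup_right).trans (degreeImage_mul_le_of_le ψ g hc n)
  have : FiniteDimensional K ↥(degreeImage g (c * n) * W) := Module.Finite.iff_fg.2
    ((degreeImage_fg g _).mul hWfg)
  calc Module.finrank K ↥(degreeImage ψ n * M₀)
      ≤ Module.finrank K ↥(degreeImage g (c * n) * W) := Submodule.finrank_mono hle
    _ ≤ Module.finrank K (degreeImage g (c * n)) * Module.finrank K W :=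
      Submodule.finrank_mul_le _ _
    _ ≤ _ := Nat.mul_le_mul_right _ (finrank_degreeImage_le g _)

/-- If `g` is injective, then the Hilbert function of `A` with respect to any polynomial
presentation grows at least like a polynomial of degree `s`. -/
theorem exists_le_finrank_degreeImage_mul (hψ : Function.Surjective ψ)
    (hg : Function.Injective g) {M₀ : Submodule K A} (hM₀ : M₀.FG)
    (hspan : Submodule.span A (M₀ : Set A) = ⊤) :
    ∃ a b : ℕ, ∀ m,
      (m + 1) ^ s ≤ Module.finrank K ↥(degreeImage ψ ((a + 1) * m + b) * M₀) := by
  have hrange : LinearMap.range ψ.toLinearMap = ⊤ := LinearMap.range_eq_top.2 hψ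
  obtain ⟨d, hd⟩ := exists_le_degreeImage_mul ψ (W := 1) (by rw [mul_one, hrange])
    (degreeImage_fg g 1)
  rw [mul_one] at hd
  have hM : LinearMap.range ψ.toLinearMap * M₀ = ⊤ := by
    rw [hrange]
    refine eq_top_iff.2 fun t _ ↦ ?_
    have ht : t ∈ Submodule.span A (M₀ : Set A) := hspan ▸ Submodule.mem_top
    induction ht using Submodule.span_induction with
    | mem x hx => simpa using Submodule.mul_mem_mul (Submodule.mem_top (x := (1 : A))) hx
    | zero => exact zero_mem _
    | add x y _ _ hx hy => exact add_mem (hx trivial) (hy trivial)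
    | smul r x _ hx =>
      have := Submodule.mul_mem_mul (Submodule.mem_top (R := K) (x := r)) (hx trivial)
      refine (?_ : (⊤ : Submodule K A) * (⊤ * M₀) ≤ ⊤ * M₀) this
      rw [← mul_assoc]
      exact mul_le_mul' le_top le_rfl
  obtain ⟨e, he⟩ := exists_le_degreeImage_mul ψ hM (Submodule.fg_span_singleton (R := K) (1 : A))
  rw [← Submodule.one_eq_span] at he
  refine ⟨d * s, e, fun m ↦ ?_⟩
  have hle : degreeImage g (s * m) ≤ degreeImage ψ ((d * s + 1) * m + e) * M₀ :=
    calc degreeImage g (s * m) = degreeImage g 1 ^ (s * m) * 1 := by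
          rw [mul_one, ← degreeImage_eq_pow]
      _ ≤ degreeImage ψ d ^ (s * m) * (degreeImage ψ e * M₀) :=
          mul_le_mul' (pow_le_pow_left' hd _) he
      _ = degreeImage ψ (d * s * m + e) * M₀ := by
          rw [degreeImage_add, mul_assoc d, degreeImage_mul, mul_assoc]
      _ ≤ degreeImage ψ ((d * s + 1) * m + e) * M₀ :=
          mul_le_mul' (degreeImage_mono ψ (by gcongr; lia)) le_rfl
  have : FiniteDimensional K ↥(degreeImage ψ ((d * s + 1) * m + e) * M₀) := Module.Finite.iff_fg.2
    ((degreeImage_fg ψ _).mul hM₀)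
  exact (le_finrank_degreeImage g hg m).trans (Submodule.finrank_mono hle)

theorem span_smul_eq_degreeImage_mul (M₀ : Submodule K A) (n : ℕ) :
    Submodule.span K {m : A | ∃ p ∈ restrictTotalDegree (Fin k) K n, ∃ v ∈ M₀, ψ p • v = m} =
      degreeImage ψ n * M₀ := by
  apply le_antisymm
  · refine Submodule.span_le.2 ?_
    rintro _ ⟨p, hp, v, hv, rfl⟩
    exact Submodule.mul_mem_mul (Submodule.mem_map_of_mem hp) hv
  · refine Submodule.mul_le.2 ?_
    rintro _ ⟨p, hp, rfl⟩ v hv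
    exact Submodule.subset_span ⟨p, hp, v, hv, rfl⟩

end degreeImage

end MvPolynomial

open Filter in
/-- Let `R` be a field, `λ` the length function given by the linear dimension
(`λ(M) = dim_R M`), and `T` a (nonzero) finitely generated commutative `R`-algebra.  Then the
λ-dimension of `T` (as a `T`-module) equals the Krull dimension of `T`: for every presentation
`φ : R[x₁,…,x_k] ↠ T`, every finitely generated `R`-submodule `M₀ ≤ T` of finite length with
`T·M₀ = T`, and every polynomial `q` with `λ(Sₙ·M₀) = q(n)` for all large `n`, the degree of `q`
equals the Krull dimension of `T`. -/
theorem stmt_17 {R : Type} [Field R] (L : LengthFunction R)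
    (hLfin : ∀ (M : Type) [AddCommGroup M] [Module R M],
      FiniteDimensional R M → L.l M = (Module.finrank R M : ℝ≥0∞))
    (hLinf : ∀ (M : Type) [AddCommGroup M] [Module R M],
      ¬ FiniteDimensional R M → L.l M = ⊤)
    (T : Type) [CommRing T] [Nontrivial T] [Algebra R T]
    (hT : Algebra.FiniteType R T) :
    ∀ (k : ℕ) (φ : MvPolynomial (Fin k) R →ₐ[R] T), Function.Surjective φ →
      ∀ M₀ : Submodule R T, M₀.FG → L.l M₀ < ⊤ →
        Submodule.span T (M₀ : Set T) = ⊤ →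
        ∀ q : Polynomial ℝ,
          (∀ᶠ n : ℕ in atTop,
            (L.l (Submodule.span R
              {m : T | ∃ p ∈ MvPolynomial.restrictTotalDegree (Fin k) R n,
                ∃ v ∈ M₀, φ p • v = m})).toReal = q.eval (n : ℝ)) →
          (q.natDegree : WithBot ℕ∞) = ringKrullDim T := by
  intro k φ hφ M₀ hM₀ _ hspan q hq
  obtain ⟨s, g, hginj, hgfin⟩ := exists_finite_inj_algHom_of_fg R T
  have hdim : ringKrullDim T = s := by
    have hgint : g.toRingHom.IsIntegral := hgfin.to_isIntegral
    algebraize [g.toRingHom]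
    rw [ringKrullDim_eq_of_isIntegral_of_injective (A := MvPolynomial (Fin s) R) (B := T) hginj,
      MvPolynomial.ringKrullDim_of_isNoetherianRing]
    simp
  rw [hdim]
  have hq' : ∀ᶠ n : ℕ in atTop,
      (Module.finrank R ↥(MvPolynomial.degreeImage φ n * M₀) : ℝ) = q.eval (n : ℝ) := by
    filter_upwards [hq] with n hn
    rw [MvPolynomial.span_smul_eq_degreeImage_mul, hLfin _ (Module.Finite.iff_fg.2
      ((MvPolynomial.degreeImage_fg φ n).mul hM₀)), ENNReal.toReal_natCast] at hn
    exact hn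
  have hle : q.natDegree ≤ s := by
    obtain ⟨c, d, hcd⟩ := MvPolynomial.exists_finrank_degreeImage_mul_le φ g hgfin hM₀
    let P : Polynomial ℝ :=
      (Polynomial.C (c : ℝ) * Polynomial.X + Polynomial.C 1) ^ s * Polynomial.C (d : ℝ)
    have hP : P.natDegree ≤ s :=
      (Polynomial.natDegree_mul_C_le _ _).trans <|
        (Polynomial.natDegree_pow_le_of_le s Polynomial.natDegree_linear_le).trans (mul_one s).le
    refine (Polynomial.natDegree_le_of_eventually_eval_natCast_le (q := P) ?_ ?_).trans hP
    · filter_upwards [hq'] with n hn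
      rw [← hn]
      positivity
    · filter_upwards [hq'] with n hn
      rw [← hn]
      simpa [P] using (Nat.cast_le (α := ℝ)).2 (hcd n)
  have hge : s ≤ q.natDegree := by
    obtain ⟨a, b, hab⟩ :=
      MvPolynomial.exists_le_finrank_degreeImage_mul φ g hφ hginj hM₀ hspan
    let P : Polynomial ℝ := (Polynomial.X + Polynomial.C 1) ^ s
    let Q : Polynomial ℝ :=
      q.comp (Polynomial.C ((a + 1 : ℕ) : ℝ) * Polynomial.X + Polynomial.C (b : ℝ))
    have hP : P.natDegree = s := by
      simp only [P, Polynomial.natDegree_pow, Polynomial.natDegree_X_add_C, mul_one]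
    have hQ : Q.natDegree ≤ q.natDegree :=
      Polynomial.natDegree_comp_le.trans <|
        (Nat.mul_le_mul_left _ Polynomial.natDegree_linear_le).trans (mul_one _).le
    have htendsto : Tendsto (fun m : ℕ ↦ (a + 1) * m + b) atTop atTop :=
      tendsto_atTop_mono (fun m ↦ by rw [id]; nlinarith [Nat.zero_le (a * m)]) tendsto_id
    rw [← hP]
    refine (Polynomial.natDegree_le_of_eventually_eval_natCast_le (q := Q) ?_ ?_).trans hQ
    · refine Eventually.of_forall fun m ↦ ?_
      simp only [P, Polynomial.eval_pow, Polynomial.eval_add, Polynomial.eval_X, Polynomial.eval_C]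
      positivity
    · filter_upwards [htendsto.eventually hq'] with m hm
      have h := (Nat.cast_le (α := ℝ)).2 (hab m)
      rw [hm] at h
      simpa [P, Q] using h
  exact_mod_cast le_antisymm hle hge
end
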